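/- arXiv:0708.1034 — 2 statements merged into one kernel-verified Lean document; each statement's English description precedes it below -/
import Mathlib

section
/- The stability problem for simplified counter machines with zero initial counters is undecidable: the set of codes of pairs (simplified counter machine (S, Γ), state s*) such that the machine started at configuration (s*, 0, 0) is stable — i.e. sup_t z₁ᵗ < ∞ and sup_t z₂ᵗ < ∞ along its trajectory — is not a computable predicate. -/
/-- The set of allowed counter increments of a two-counter machine. -/
def CM.Deltas : Set (ℤ × ℤ) := {(-1, 0), (0, -1), (0, 0), (1, 0), (0, 1)}

/-- One step of a two-counter machine with transition function `Γ`: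
a configuration `(s, z₁, z₂)` is updated to `(s', (z₁ + d₁)⁺, (z₂ + d₂)⁺)`
where `(s', (d₁, d₂)) = Γ s 1{z₁ > 0} 1{z₂ > 0}`. -/
def CM.step {S : Type*} (Γ : S → Bool → Bool → S × ℤ × ℤ) (c : S × ℕ × ℕ) : S × ℕ × ℕ :=
  let r := Γ c.1 (decide (0 < c.2.1)) (decide (0 < c.2.2))
  (r.1, ((c.2.1 : ℤ) + r.2.1).toNat, ((c.2.2 : ℤ) + r.2.2).toNat)

/-- The trajectory of the counter machine `Γ` started from configuration `c`. -/
def CM.traj {S : Type*} (Γ : S → Bool → Bool → S × ℤ × ℤ) (c : S × ℕ × ℕ) (t : ℕ) :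
    S × ℕ × ℕ :=
  (CM.step Γ)^[t] c

/-- `Γ` is a valid counter-machine transition function: every increment lies in
`CM.Deltas`, and `Γ` is consistent (it never decrements a counter whose value is zero). -/
def CM.Valid {S : Type*} (Γ : S → Bool → Bool → S × ℤ × ℤ) : Prop :=
  (∀ s b₁ b₂, (Γ s b₁ b₂).2 ∈ CM.Deltas) ∧
  (∀ s b₁ b₂, ((Γ s b₁ b₂).2.1 = -1 → b₁ = true) ∧ ((Γ s b₁ b₂).2.2 = -1 → b₂ = true))

/-- The machine `Γ` started at configuration `c` is stable: both counter values
are bounded along the trajectory. -/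
def CM.Stable {S : Type*} (Γ : S → Bool → Bool → S × ℤ × ℤ) (c : S × ℕ × ℕ) : Prop :=
  ∃ B : ℕ, ∀ t : ℕ, (CM.traj Γ c t).2.1 ≤ B ∧ (CM.traj Γ c t).2.2 ≤ B

/-- `Γ` is a simplified counter machine: the increment applied at each step is a
function of the new state only. -/
def CM.IsSCM {S : Type*} (Γ : S → Bool → Bool → S × ℤ × ℤ) : Prop :=
  ∃ (α : S → Bool → Bool → S) (β : S → ℤ × ℤ),
    ∀ s b₁ b₂, Γ s b₁ b₂ = (α s b₁ b₂, β (α s b₁ b₂))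

/-- The allowed increments, as a type. -/
def CM.Delta : Type := {d : ℤ × ℤ // d ∈ CM.Deltas}

/-- The simplified counter machine associated to a counter machine `Γ`, with state
space `S ⊕ (S × D)`: `Γ' (inl s) b₁ b₂ = (inr (s', Δ), Δ)` where `(s', Δ) = Γ s b₁ b₂`,
and `Γ' (inr (s', Δ)) b₁ b₂ = (inl s', (0, 0))`. -/
def CM.simplify {S : Type*} (Γ : S → Bool → Bool → S × ℤ × ℤ)
    (h : ∀ s b₁ b₂, (Γ s b₁ b₂).2 ∈ CM.Deltas) :
    (S ⊕ S × CM.Delta) → Bool → Bool → (S ⊕ S × CM.Delta) × ℤ × ℤ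
  | Sum.inl s, b₁, b₂ =>
      (Sum.inr ((Γ s b₁ b₂).1, ⟨(Γ s b₁ b₂).2, h s b₁ b₂⟩), (Γ s b₁ b₂).2)
  | Sum.inr p, _, _ => (Sum.inl p.1, (0, 0))

/-- Codes of pairs (two-counter machine with state set `Fin m`, state `s*`). -/
def CMStateCode : Type :=
  Σ m : ℕ, (Fin m → Bool → Bool → Fin m × ℤ × ℤ) × Fin m

instance : Encodable CMStateCode := by unfold CMStateCode; infer_instance

namespace CM

theorem traj_add {S : Type*} (Γ : S → Bool → Bool → S × ℤ × ℤ) (c : S × ℕ × ℕ) (t u : ℕ) :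
    traj Γ c (t + u) = traj Γ (traj Γ c t) u := by
  rw [traj, add_comm, Function.iterate_add_apply]
  rfl

theorem traj_succ {S : Type*} (Γ : S → Bool → Bool → S × ℤ × ℤ) (c : S × ℕ × ℕ) (t : ℕ) :
    traj Γ c (t + 1) = step Γ (traj Γ c t) :=
  traj_add Γ c t 1

/-- Stability does not depend on a finite initial part of the trajectory. -/
theorem stable_traj_iff {S : Type*} (Γ : S → Bool → Bool → S × ℤ × ℤ) (c : S × ℕ × ℕ) (t : ℕ) :
    Stable Γ (traj Γ c t) ↔ Stable Γ c := by
  constructor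
  · rintro ⟨B, hB⟩
    refine ⟨B + ∑ u ∈ Finset.range t, ((traj Γ c u).2.1 + (traj Γ c u).2.2), fun u => ?_⟩
    rcases lt_or_ge u t with h | h
    · have := Finset.single_le_sum
        (f := fun u => (traj Γ c u).2.1 + (traj Γ c u).2.2) (fun _ _ => Nat.zero_le _)
        (Finset.mem_range.2 h)
      omega
    · have := hB (u - t)
      rw [← traj_add, Nat.add_sub_cancel' h] at this
      omega
  · rintro ⟨B, hB⟩
    exact ⟨B, fun u => by rw [← traj_add]; exact hB _⟩

/-- Instructions of two-counter programs whose addresses are natural numbers. The counters are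
indexed by `Bool`; `dec c t e` jumps to `e` if the counter `c` is zero, and otherwise decrements
it and jumps to `t`. -/
inductive Instr
  | jump (t : ℕ)
  | inc (c : Bool) (t : ℕ)
  | dec (c : Bool) (t e : ℕ)

/-- The next address and the number of the increment (see `deltaOf`) of an instruction. -/
def Instr.next : Instr → Bool → Bool → ℕ × ℕ
  | jump t, _, _ => (t, 0)
  | inc false t, _, _ => (t, 1)
  | inc true t, _, _ => (t, 2)
  | dec false t _, true, _ => (t, 3)
  | dec false _ e, false, _ => (e, 0)
  | dec true t _, _, true => (t, 4)
  | dec true _ e, _, false => (e, 0)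

/-- A numbering of the allowed increments by `0, …, 4`. -/
def deltaOf : ℕ → ℤ × ℤ
  | 1 => (1, 0)
  | 2 => (0, 1)
  | 3 => (-1, 0)
  | 4 => (0, -1)
  | _ => (0, 0)

theorem deltaOf_mem (d : ℕ) : deltaOf d ∈ Deltas := by
  unfold deltaOf Deltas
  split <;> simp

theorem Instr.next_lt (I : Instr) (b₁ b₂ : Bool) : (I.next b₁ b₂).2 < 5 := by
  unfold Instr.next
  split <;> simp

theorem Instr.next_consistent (I : Instr) (b₁ b₂ : Bool) :
    ((deltaOf (I.next b₁ b₂).2).1 = -1 → b₁ = true) ∧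
      ((deltaOf (I.next b₁ b₂).2).2 = -1 → b₂ = true) := by
  unfold Instr.next
  split <;> simp [deltaOf]

/-- The transition function of a program. -/
def progTrans (P : ℕ → Instr) (i : ℕ) (b₁ b₂ : Bool) : ℕ × ℤ × ℤ :=
  (((P i).next b₁ b₂).1, deltaOf ((P i).next b₁ b₂).2)

/-- The program `P` gets from configuration `c` to configuration `d`. -/
def Reach (P : ℕ → Instr) (c d : ℕ × ℕ × ℕ) : Prop :=
  ∃ t, traj (progTrans P) c t = d

/-- The pair of counter values with value `x` for counter `c` and `y` for the other one. -/
def put (c : Bool) (x y : ℕ) : ℕ × ℕ := bif c then (y, x) else (x, y)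

theorem put_not (c : Bool) (x y : ℕ) : put (!c) x y = put c y x := by cases c <;> rfl

section Reach

variable {P : ℕ → Instr} {a t e x y : ℕ} {c : Bool} {d d₁ d₂ : ℕ × ℕ × ℕ} {z : ℕ × ℕ}

theorem Reach.refl (P : ℕ → Instr) (d : ℕ × ℕ × ℕ) : Reach P d d := ⟨0, rfl⟩

theorem Reach.trans (h₁ : Reach P d d₁) (h₂ : Reach P d₁ d₂) : Reach P d d₂ := by
  obtain ⟨t, rfl⟩ := h₁
  obtain ⟨u, rfl⟩ := h₂
  exact ⟨t + u, traj_add _ _ _ _⟩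

theorem Reach.of_step (h : step (progTrans P) d = d₁) : Reach P d d₁ := ⟨1, h⟩

theorem Reach.stable_iff (h : Reach P d d₁) :
    Stable (progTrans P) d₁ ↔ Stable (progTrans P) d := by
  obtain ⟨t, rfl⟩ := h
  exact stable_traj_iff _ _ _

theorem reach_jump (h : P a = .jump t) : Reach P (a, z) (t, z) :=
  .of_step <| by simp [step, progTrans, h, Instr.next, deltaOf]

theorem reach_inc (h : P a = .inc c t) : Reach P (a, put c x y) (t, put c (x + 1) y) :=
  .of_step <| by cases c <;> simp [step, progTrans, h, Instr.next, deltaOf, put]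

theorem reach_dec_succ (h : P a = .dec c t e) :
    Reach P (a, put c (x + 1) y) (t, put c x y) :=
  .of_step <| by cases c <;> simp [step, progTrans, h, Instr.next, deltaOf, put]

theorem reach_dec_zero (h : P a = .dec c t e) : Reach P (a, put c 0 y) (e, put c 0 y) :=
  .of_step <| by cases c <;> simp [step, progTrans, h, Instr.next, deltaOf, put]

end Reach

/-- Code moving `p` times the value of counter `c` to the other counter. -/
theorem exists_transfer (c : Bool) {p : ℕ} (hp : 0 < p) (a : ℕ) :
    ∃ b, a ≤ b ∧ ∃ Q : ℕ → Instr, ∀ P : ℕ → Instr, (∀ i, a ≤ i → i < b → P i = Q i) →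
      ∀ x y, Reach P (a, put c x y) (b, put c 0 (y + p * x)) := by
  refine ⟨a + 1 + p, by omega, fun i => if i = a then .dec c (a + 1) (a + 1 + p) else
    .inc (!c) (if i = a + p then a else i + 1), fun P hP => ?_⟩
  beta_reduce at hP
  have hdec : P a = .dec c (a + 1) (a + 1 + p) := by simp [hP a le_rfl (by omega)]
  have hinc : ∀ j, j < p → ∀ x y, Reach P (a + p - j, put c x y) (a, put c x (y + j + 1)) := by
    intro j
    induction j with
    | zero =>
      intro _ x y
      have h : P (a + p) = .inc (!c) a := by
        rw [hP _ (by omega) (by omega), if_neg (by omega), if_pos rfl]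
      simpa [put_not] using reach_inc (x := y) (y := x) h
    | succ j ih =>
      intro hj x y
      have h : P (a + p - (j + 1)) = .inc (!c) (a + p - j) := by
        rw [hP _ (by omega) (by omega), if_neg (by omega), if_neg (by omega)]
        congr 1
        omega
      have h₁ := reach_inc (x := y) (y := x) h
      rw [put_not, put_not] at h₁
      have h₂ := ih (by omega) x (y + 1)
      rw [show y + 1 + j + 1 = y + (j + 1) + 1 by omega] at h₂
      exact h₁.trans h₂
  intro x
  induction x with
  | zero => exact fun y => reach_dec_zero hdec
  | succ x ih =>
    intro y
    have h := hinc (p - 1) (by omega) x y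
    rw [show a + p - (p - 1) = a + 1 by omega, show y + (p - 1) + 1 = y + p by omega] at h
    have h' := ih (y + p)
    rw [show y + p + p * x = y + p * (x + 1) by ring] at h'
    exact (reach_dec_succ hdec).trans (h.trans h')

/-- Code dividing the first counter by `p` into the second one if it is divisible by `p`,
and leaving it unchanged otherwise. -/
theorem exists_div {p : ℕ} (hp : 0 < p) (a : ℕ) :
    ∃ b, a ≤ b ∧ ∃ Q : ℕ → Instr, ∀ P : ℕ → Instr, (∀ i, a ≤ i → i < b → P i = Q i) →
      (∀ q, Reach P (a, p * q, 0) (b, 0, q)) ∧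
        ∀ N, ¬ p ∣ N → Reach P (a, N, 0) (b, N, 0) := by
  obtain ⟨b, hb, Q, hQ⟩ := exists_transfer true hp (a + 2 * p)
  refine ⟨b, by omega, fun i =>
    if i < a + p then .dec false (i + 1) (if i = a then b else 2 * (a + p) - i)
    else if i = a + p then .inc true a else if i < a + 2 * p then .inc false (i + 1) else Q i,
    fun P hP => ?_⟩
  beta_reduce at hP
  have hD : ∀ j < p,
      P (a + j) = .dec false (a + j + 1) (if j = 0 then b else a + 2 * p - j) := by
    intro j hj
    rw [hP _ (by omega) (by omega), if_pos (by omega)]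
    congr 1
    split_ifs <;> omega
  have hI : P (a + p) = .inc true a := by
    rw [hP _ (by omega) (by omega), if_neg (by omega), if_pos rfl]
  have hU : ∀ i, a + p < i → i < a + 2 * p → P i = .inc false (i + 1) := by
    intro i h₁ h₂
    rw [hP _ (by omega) (by omega), if_neg (by omega), if_neg (by omega), if_pos h₂]
  have hT := hQ P fun i h₁ h₂ => by
    rw [hP _ (by omega) h₂, if_neg (by omega), if_neg (by omega), if_neg (by omega)]
  have down : ∀ j ≤ p, ∀ x y, Reach P (a, x + j, y) (a + j, x, y) := by
    intro j
    induction j with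
    | zero => exact fun _ x y => Reach.refl _ _
    | succ j ih =>
      intro hj x y
      have h := ih (by omega) (x + 1) y
      rw [show x + 1 + j = x + (j + 1) by omega] at h
      exact h.trans (reach_dec_succ (c := false) (hD j (by omega)))
  have rounds : ∀ q x y, Reach P (a, p * q + x, y) (a, x, y + q) := by
    intro q
    induction q with
    | zero => exact fun x y => by simpa using Reach.refl _ _
    | succ q ih =>
      intro x y
      have h := down p le_rfl (p * q + x) y
      rw [show p * q + x + p = p * (q + 1) + x by ring] at h
      have h' := ih x (y + 1)
      rw [show y + 1 + q = y + (q + 1) by ring] at h'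
      exact (h.trans (reach_inc (c := true) hI)).trans h'
  have up : ∀ j < p, ∀ x y, Reach P (a + 2 * p - j, x, y) (a + 2 * p, x + j, y) := by
    intro j
    induction j with
    | zero => exact fun _ x y => Reach.refl _ _
    | succ j ih =>
      intro hj x y
      have h := reach_inc (c := false) (x := x) (y := y) (hU (a + 2 * p - (j + 1)) (by omega)
        (by omega))
      have h' := ih (by omega) (x + 1) y
      rw [show x + 1 + j = x + (j + 1) by omega] at h'
      rw [show a + 2 * p - (j + 1) + 1 = a + 2 * p - j by omega] at h
      exact h.trans h'
  refine ⟨fun q => ?_, fun N hN => ?_⟩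
  · have h := rounds q 0 0
    rw [zero_add] at h
    exact h.trans (reach_dec_zero (c := false) (y := q) (hD 0 hp))
  · have hj : N % p ≠ 0 := fun h => hN (Nat.dvd_of_mod_eq_zero h)
    have hjp := Nat.mod_lt N hp
    have h₁ := rounds (N / p) (N % p) 0
    have h₂ := down (N % p) hjp.le 0 (N / p)
    have h₃ := reach_dec_zero (c := false) (y := N / p) (hD (N % p) hjp)
    have h₄ := up (N % p) hjp 0 (N / p)
    have h₅ := hT (N / p) (N % p)
    rw [if_neg hj] at h₃
    rw [Nat.div_add_mod, zero_add] at h₁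
    rw [zero_add] at h₂ h₄
    rw [Nat.mod_add_div] at h₅
    exact h₁.trans (h₂.trans (h₃.trans (h₄.trans h₅)))

/-- `z` encodes the register contents `σ`: the second counter is zero, and the exponents of the
prime numbers in the first one are the values of the registers. -/
def Encodes (σ : ℕ → ℕ) (z : ℕ × ℕ) : Prop :=
  z.1 ≠ 0 ∧ z.2 = 0 ∧ ∀ r, z.1.factorization (Nat.nth Nat.Prime r) = σ r

/-- The relation `R` between register contents before and after a computation is realized by a
piece of two-counter code that can be placed at any address. -/
def Realizable (R : (ℕ → ℕ) → (ℕ → ℕ) → Prop) : Prop :=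
  ∀ a, ∃ b, a ≤ b ∧ ∃ Q : ℕ → Instr, ∀ P : ℕ → Instr, (∀ i, a ≤ i → i < b → P i = Q i) →
    ∀ σ σ' z, Encodes σ z → R σ σ' → ∃ z', Encodes σ' z' ∧ Reach P (a, z) (b, z')

theorem prime_nth (r : ℕ) : (Nat.nth Nat.Prime r).Prime :=
  Nat.nth_mem_of_infinite Nat.infinite_setOfPred_prime r

theorem factorization_nth_prime (r s : ℕ) :
    (Nat.nth Nat.Prime r).factorization (Nat.nth Nat.Prime s) = if s = r then 1 else 0 := by
  rw [(prime_nth r).factorization, Finsupp.single_apply]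
  simp only [(Nat.nth_injective Nat.infinite_setOfPred_prime).eq_iff, eq_comm]

theorem Encodes.mul {σ : ℕ → ℕ} {N : ℕ} (h : Encodes σ (N, 0)) (r : ℕ) :
    Encodes (Function.update σ r (σ r + 1)) (Nat.nth Nat.Prime r * N, 0) := by
  obtain ⟨h₀, -, h⟩ := h
  refine ⟨mul_ne_zero (prime_nth r).ne_zero h₀, rfl, fun s => ?_⟩
  simp only at h h₀ ⊢
  rw [Nat.factorization_mul (prime_nth r).ne_zero h₀, Finsupp.add_apply, h,
    factorization_nth_prime, Function.update_apply]
  split_ifs with hs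
  · rw [hs, add_comm]
  · rw [zero_add]

theorem Encodes.of_mul {σ : ℕ → ℕ} {r N : ℕ} (h : Encodes σ (Nat.nth Nat.Prime r * N, 0)) :
    Encodes (Function.update σ r (σ r - 1)) (N, 0) := by
  obtain ⟨h₀, -, h⟩ := h
  simp only at h h₀
  have hN : N ≠ 0 := right_ne_zero_of_mul h₀
  refine ⟨hN, rfl, fun s => ?_⟩
  have hs := h s
  have hr := h r
  rw [Nat.factorization_mul (prime_nth r).ne_zero hN, Finsupp.add_apply,
    factorization_nth_prime] at hs hr
  rw [Function.update_apply]
  rw [if_pos rfl] at hr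
  dsimp only
  split_ifs at hs ⊢ with hsr
  · subst hsr
    omega
  · omega

theorem Encodes.dvd_iff {σ : ℕ → ℕ} {N : ℕ} (h : Encodes σ (N, 0)) (r : ℕ) :
    Nat.nth Nat.Prime r ∣ N ↔ σ r ≠ 0 := by
  rw [← h.2.2 r, ← Nat.one_le_iff_ne_zero]
  exact (prime_nth r).dvd_iff_one_le_factorization h.1

theorem Realizable.mono {R R' : (ℕ → ℕ) → (ℕ → ℕ) → Prop} (h : Realizable R)
    (hR : ∀ σ σ', R' σ σ' → R σ σ') : Realizable R' := by
  intro a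
  obtain ⟨b, hb, Q, hQ⟩ := h a
  exact ⟨b, hb, Q, fun P hP σ σ' z hz hσ => hQ P hP σ σ' z hz (hR _ _ hσ)⟩

theorem Realizable.skip : Realizable Eq := fun a =>
  ⟨a, le_rfl, fun _ => .jump 0, fun _ _ _ _ z hz h => ⟨z, h ▸ hz, Reach.refl _ _⟩⟩

theorem Realizable.seq {R S : (ℕ → ℕ) → (ℕ → ℕ) → Prop} (hR : Realizable R)
    (hS : Realizable S) : Realizable (Relation.Comp R S) := by
  intro a
  obtain ⟨b, hb, Q₁, h₁⟩ := hR a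
  obtain ⟨c, hc, Q₂, h₂⟩ := hS b
  refine ⟨c, hb.trans hc, fun i => if i < b then Q₁ i else Q₂ i, fun P hP σ σ' z hz hσ => ?_⟩
  beta_reduce at hP
  obtain ⟨τ, hτ, hτ'⟩ := hσ
  obtain ⟨z₁, hz₁, hr₁⟩ := h₁ P (fun i hi hi' => by
    rw [hP i hi (by omega), if_pos hi']) σ τ z hz hτ
  obtain ⟨z₂, hz₂, hr₂⟩ := h₂ P (fun i hi hi' => by
    rw [hP i (by omega) hi', if_neg (by omega)]) τ σ' z₁ hz₁ hτ'
  exact ⟨z₂, hz₂, hr₁.trans hr₂⟩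

theorem Realizable.inc (r : ℕ) :
    Realizable fun σ σ' => σ' = Function.update σ r (σ r + 1) := by
  intro a
  obtain ⟨b, hb, Q₁, h₁⟩ := exists_transfer false (prime_nth r).pos a
  obtain ⟨c, hc, Q₂, h₂⟩ := exists_transfer true one_pos b
  refine ⟨c, hb.trans hc, fun i => if i < b then Q₁ i else Q₂ i, ?_⟩
  rintro P hP σ _ ⟨N, w⟩ hz rfl
  beta_reduce at hP
  obtain rfl : w = 0 := hz.2.1
  have hr₁ := h₁ P (fun i hi hi' => by rw [hP i hi (by omega), if_pos hi']) N 0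
  have hr₂ := h₂ P (fun i hi hi' => by rw [hP i (by omega) hi', if_neg (by omega)])
    (Nat.nth Nat.Prime r * N) 0
  refine ⟨_, hz.mul r, ?_⟩
  rw [zero_add] at hr₁ hr₂
  rw [one_mul] at hr₂
  exact hr₁.trans hr₂

/-- Code for a loop that, as long as the register `r` is nonzero, decrements it and runs a
given piece of code. -/
theorem Realizable.exists_loop {R : (ℕ → ℕ) → (ℕ → ℕ) → Prop} (hR : Realizable R) (r a : ℕ) :
    ∃ b, a ≤ b ∧ ∃ Q : ℕ → Instr, ∀ P : ℕ → Instr, (∀ i, a ≤ i → i < b → P i = Q i) →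
      ∀ σ z, Encodes σ z → (σ r = 0 → Reach P (a, z) (b, z)) ∧
        ∀ σ', σ r ≠ 0 → R (Function.update σ r (σ r - 1)) σ' →
          ∃ z', Encodes σ' z' ∧ Reach P (a, z) (a, z') := by
  obtain ⟨b, hb, Q₁, h₁⟩ := exists_div (prime_nth r).pos a
  obtain ⟨c, hc, Q₂, h₂⟩ := exists_transfer true one_pos (b + 2)
  obtain ⟨d, hd, Q₃, h₃⟩ := hR c
  refine ⟨d + 1, by omega, fun i => if i < b then Q₁ i else if i = b then .dec true (b + 1) (d + 1)
    else if i = b + 1 then .inc true (b + 2) else if i < c then Q₂ i else if i < d then Q₃ i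
    else .jump a, ?_⟩
  rintro P hP σ ⟨N, w⟩ hz
  beta_reduce at hP
  obtain rfl : w = 0 := hz.2.1
  obtain ⟨hdiv, hndiv⟩ := h₁ P fun i hi hi' => by rw [hP i hi (by omega), if_pos hi']
  have hdec : P b = .dec true (b + 1) (d + 1) := by
    rw [hP b hb (by omega), if_neg (by omega), if_pos rfl]
  refine ⟨fun h => ?_, fun σ' h hσ' => ?_⟩
  · exact (hndiv N fun h' => (hz.dvd_iff r).1 h' h).trans
      (reach_dec_zero (c := true) (y := N) hdec)
  · obtain ⟨q, rfl⟩ := (hz.dvd_iff r).2 h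
    have hq := hz.of_mul
    obtain ⟨k, rfl⟩ := Nat.exists_eq_succ_of_ne_zero hq.1
    have hinc : P (b + 1) = .inc true (b + 2) := by
      rw [hP _ (by omega) (by omega), if_neg (by omega), if_neg (by omega), if_pos rfl]
    have hjump : P d = .jump a := by
      rw [hP _ (by omega) (by omega), if_neg (by omega), if_neg (by omega), if_neg (by omega),
        if_neg (by omega), if_neg (by omega)]
    have hr₂ := h₂ P (fun i hi hi' => by
      rw [hP _ (by omega) (by omega), if_neg (by omega), if_neg (by omega), if_neg (by omega),
        if_pos hi']) (k + 1) 0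
    rw [zero_add, one_mul] at hr₂
    obtain ⟨z', hz', hr₃⟩ := h₃ P (fun i hi hi' => by
      rw [hP _ (by omega) (by omega), if_neg (by omega), if_neg (by omega), if_neg (by omega),
        if_neg (by omega), if_pos hi']) _ σ' _ hq hσ'
    exact ⟨z', hz', (hdiv _).trans <| (reach_dec_succ (c := true) (x := k) (y := 0) hdec).trans <|
      (reach_inc (c := true) hinc).trans <| hr₂.trans <| hr₃.trans <| reach_jump hjump⟩

/-- If the register `r` counts the values of `τ` down to zero and `R` relates consecutive values
of `τ`, then a loop computes the last value from the first one. -/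
theorem Realizable.loop {R : (ℕ → ℕ) → (ℕ → ℕ) → Prop} (hR : Realizable R) (r : ℕ)
    (τ : (ℕ → ℕ) → ℕ → ℕ → ℕ) :
    Realizable fun σ σ' => (τ σ 0 = σ ∧ τ σ (σ r) = σ' ∧ ∀ i, τ σ i r = σ r - i) ∧
      ∀ i < σ r, R (Function.update (τ σ i) r (τ σ i r - 1)) (τ σ (i + 1)) := by
  intro a
  obtain ⟨b, hb, Q, hQ⟩ := hR.exists_loop r a
  refine ⟨b, hb, Q, ?_⟩
  rintro P hP σ _ z hz ⟨⟨h₀, rfl, hr⟩, hstep⟩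
  have key : ∀ i ≤ σ r, ∃ z', Encodes (τ σ i) z' ∧ Reach P (a, z) (a, z') := by
    intro i
    induction i with
    | zero => exact fun _ => ⟨z, by rwa [h₀], Reach.refl _ _⟩
    | succ i ih =>
      intro hi
      obtain ⟨z₁, hz₁, h₁⟩ := ih (by omega)
      obtain ⟨z₂, hz₂, h₂⟩ := (hQ P hP _ z₁ hz₁).2 _ (by rw [hr]; omega) (hstep i (by omega))
      exact ⟨z₂, hz₂, h₁.trans h₂⟩
  obtain ⟨z', hz', h⟩ := key _ le_rfl
  exact ⟨z', hz', h.trans ((hQ P hP _ z' hz').1 (by rw [hr, Nat.sub_self]))⟩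

theorem Realizable.clear (r : ℕ) :
    Realizable fun σ σ' => σ' = Function.update σ r 0 := by
  refine (Realizable.skip.loop r fun σ i => Function.update σ r (σ r - i)).mono ?_
  rintro σ _ rfl
  simp [Nat.sub_sub]

theorem Realizable.move {s t : ℕ} (hst : s ≠ t) :
    Realizable fun σ σ' => σ' = Function.update (Function.update σ s 0) t (σ t + σ s) := by
  refine ((Realizable.inc t).loop s fun σ i =>
    Function.update (Function.update σ s (σ s - i)) t (σ t + i)).mono ?_
  rintro σ _ rfl
  refine ⟨⟨by simp, by simp, by simp [hst]⟩, fun i _ => ?_⟩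
  funext x
  simp only [Function.update_apply]
  split_ifs <;> omega

theorem Realizable.copy {s o t : ℕ} (hso : s ≠ o) (hst : s ≠ t) (hot : o ≠ t) :
    Realizable fun σ σ' => σ o = 0 ∧ σ t = 0 ∧ σ' = Function.update σ o (σ s) := by
  refine ((((Realizable.inc o).seq (.inc t)).loop s fun σ i => Function.update (Function.update
    (Function.update σ s (σ s - i)) o (σ o + i)) t (σ t + i)).seq (.move hst.symm)).mono ?_
  rintro σ _ ⟨ho, ht, rfl⟩
  refine ⟨_, ⟨⟨by simp, rfl, by simp [hst, hso]⟩, fun i _ => ⟨_, rfl, ?_⟩⟩, ?_⟩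
  all_goals
    funext x
    simp only [Function.update_apply]
    grind

theorem Realizable.clearRange (b n : ℕ) :
    Realizable fun σ σ' => σ' = fun x => if b ≤ x ∧ x < b + n then 0 else σ x := by
  induction n with
  | zero =>
    refine Realizable.skip.mono ?_
    rintro σ _ rfl
    funext x
    grind
  | succ n ih =>
    refine (ih.seq (.clear (b + n))).mono ?_
    rintro σ _ rfl
    refine ⟨_, rfl, ?_⟩
    funext x
    simp only [Function.update_apply]
    grind

/-- The function `f` can be computed from any input registers into any output register, with
work registers from any address on. -/
def RegComputable {n : ℕ} (f : List.Vector ℕ n → ℕ) : Prop :=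
  ∀ (ins : Fin n → ℕ) (o b : ℕ), (∀ i, ins i < b) → o < b → (∀ i, ins i ≠ o) →
    Realizable fun σ σ' => σ o = 0 ∧ (∀ x, b ≤ x → σ x = 0) ∧
      σ' = Function.update σ o (f (List.Vector.ofFn fun i => σ (ins i)))

theorem RegComputable.zero : RegComputable fun _ : List.Vector ℕ 0 => 0 := by
  intro ins o b _ _ _
  refine Realizable.skip.mono ?_
  rintro σ _ ⟨ho, -, rfl⟩
  simp [← ho]

theorem RegComputable.get {n : ℕ} (i : Fin n) :
    RegComputable fun v : List.Vector ℕ n => v.get i := by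
  intro ins o b hb hob ho
  refine (Realizable.copy (ho i) (hb i).ne hob.ne).mono ?_
  rintro σ _ ⟨h, hz, rfl⟩
  exact ⟨h, hz b le_rfl, by simp⟩

theorem RegComputable.succ : RegComputable fun v : List.Vector ℕ 1 => v.head.succ := by
  intro ins o b hb hob ho
  refine ((Realizable.copy (ho 0) (hb 0).ne hob.ne).seq (.inc o)).mono ?_
  rintro σ _ ⟨h, hz, rfl⟩
  exact ⟨_, ⟨h, hz b le_rfl, rfl⟩, by simp [List.Vector.ofFn]⟩

theorem RegComputable.comp {m n : ℕ} {f : List.Vector ℕ n → ℕ}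
    {g : Fin n → List.Vector ℕ m → ℕ} (hf : RegComputable f) (hg : ∀ i, RegComputable (g i)) :
    RegComputable fun v => f (List.Vector.ofFn fun i => g i v) := by
  intro ins o b hb hob ho
  have hargs : ∀ k ≤ n, Realizable fun σ σ' => (∀ x, b ≤ x → σ x = 0) ∧ σ' = fun x =>
      if h : b ≤ x ∧ x < b + k ∧ x - b < n then
        g ⟨x - b, h.2.2⟩ (List.Vector.ofFn fun i => σ (ins i)) else σ x := by
    intro k
    induction k with
    | zero =>
      intro _
      refine Realizable.skip.mono ?_
      rintro σ _ ⟨-, rfl⟩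
      funext x
      rw [dif_neg (by omega)]
    | succ k ih =>
      intro hk
      refine ((ih (by omega)).seq (hg ⟨k, hk⟩ ins (b + k) (b + n)
        (fun i => (hb i).trans_le (by omega)) (by omega)
        (fun i => ((hb i).trans_le (by omega)).ne))).mono ?_
      rintro σ _ ⟨hz, rfl⟩
      refine ⟨_, ⟨hz, rfl⟩, ?_, ?_, ?_⟩
      · dsimp only
        rw [dif_neg (by omega), hz _ (by omega)]
      · intro x hx
        dsimp only
        rw [dif_neg (by omega), hz _ (by omega)]
      · have hins : ∀ i, ¬ b ≤ ins i := fun i => (hb i).not_ge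
        funext x
        simp only [Function.update_apply, hins, false_and, dite_false]
        by_cases hx : x = b + k
        · subst hx
          rw [dif_pos (by omega), if_pos rfl]
          simp
        · rw [if_neg hx]
          by_cases hx' : b ≤ x ∧ x < b + k ∧ x - b < n
          · rw [dif_pos (by omega), dif_pos hx']
          · rw [dif_neg (by omega), dif_neg hx']
  refine (((hargs n le_rfl).seq (hf (fun i => b + i) o (b + n) (by simp) (by omega)
    (fun i => by omega))).seq (.clearRange b n)).mono ?_
  rintro σ _ ⟨h, hz, rfl⟩
  refine ⟨_, ⟨_, ⟨hz, rfl⟩, ?_, ?_, rfl⟩, ?_⟩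
  · dsimp only
    rwa [dif_neg (by omega)]
  · intro x hx
    dsimp only
    rw [dif_neg (by omega), hz x (by omega)]
  · funext x
    simp only [Function.update_apply]
    by_cases hx : x = o
    · subst hx
      rw [if_pos rfl, if_neg (by omega), if_pos rfl]
      congr 2
      funext i
      rw [dif_pos (by omega)]
      simp
    · rw [if_neg hx, if_neg hx]
      by_cases hx' : b ≤ x ∧ x < b + n
      · rw [if_pos hx', hz x hx'.1]
      · rw [if_neg hx', dif_neg (by omega)]

theorem RegComputable.iterate {n : ℕ} {g : List.Vector ℕ (n + 2) → ℕ} (hg : RegComputable g)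
    {ins : Fin n → ℕ} {o b : ℕ} (hb : ∀ i, ins i < b) (hob : o < b) (ho : ∀ i, ins i ≠ o) :
    Realizable fun σ σ' => (∀ x, b < x → σ x = 0) ∧ ∃ ρ : ℕ → ℕ, ρ 0 = σ o ∧
      (∀ i, ρ (i + 1) = g (i ::ᵥ ρ i ::ᵥ List.Vector.ofFn fun j => σ (ins j))) ∧
      σ' = Function.update (Function.update σ b 0) o (ρ (σ b)) := by
  have hbody := ((hg (Fin.cons (b + 1) (Fin.cons o ins)) (b + 2) (b + 3)
    (Fin.cases (by simp) (Fin.cases (by simp; omega) fun i =>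
      (hb i).trans_le (by omega))) (by omega)
    (Fin.cases (by simp) (Fin.cases (by simp; omega) fun i =>
      ((hb i).trans_le (by omega)).ne))).seq (.clear o)).seq
    ((Realizable.move (s := b + 2) (t := o) (by omega)).seq (.inc (b + 1)))
  obtain ⟨ρ, hρ₀, hρ⟩ : ∃ ρ : (ℕ → ℕ) → ℕ → ℕ, (∀ σ, ρ σ 0 = σ o) ∧
      ∀ σ i, ρ σ (i + 1) = g (i ::ᵥ ρ σ i ::ᵥ List.Vector.ofFn fun j => σ (ins j)) :=
    ⟨fun σ i => i.rec (σ o) fun i IH => g (i ::ᵥ IH ::ᵥ List.Vector.ofFn fun j => σ (ins j)),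
      fun _ => rfl, fun _ _ => rfl⟩
  have hloop := hbody.loop b fun σ i => Function.update (Function.update (Function.update σ
    b (σ b - i)) (b + 1) i) o (ρ σ i)
  refine (hloop.seq (.clear (b + 1))).mono ?_
  rintro σ _ ⟨hz, ρ', h₀, hs, rfl⟩
  obtain rfl : ρ' = ρ σ := by
    funext i
    induction i with
    | zero => rw [h₀, hρ₀]
    | succ i ih => rw [hs, hρ, ih]
  have hz₁ := hz (b + 1) (by omega)
  have hz₂ := hz (b + 2) (by omega)
  refine ⟨_, ⟨⟨?_, rfl, ?_⟩, fun i hi => ⟨_, ⟨_, ⟨?_, ?_, rfl⟩, rfl⟩, _, rfl, ?_⟩⟩, ?_⟩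
  · funext x
    simp only [Function.update_apply]
    split_ifs <;> simp_all
  · intro i
    simp [hob.ne']
  · simp [hz₂, show b + 2 ≠ o by omega]
  · intro x hx
    simp [show x ≠ o by omega, show x ≠ b by omega, show x ≠ b + 1 by omega,
      hz x (by omega)]
  · have hins : ∀ j, ins j ≠ b ∧ ins j ≠ b + 1 := fun j => by
      have := hb j
      omega
    have hv : (List.Vector.ofFn fun j => Function.update (Function.update (Function.update
        (Function.update σ b (σ b - i)) (b + 1) i) o (ρ σ i)) b (σ b - i - 1)
          ((Fin.cons (b + 1) (Fin.cons o ins) : Fin (n + 2) → ℕ) j)) =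
        i ::ᵥ ρ σ i ::ᵥ List.Vector.ofFn fun j => σ (ins j) := by
      simp [List.Vector.ofFn, hob.ne, hins, ho, show b + 1 ≠ o by omega]
    rw [Function.update_of_ne hob.ne', Function.update_of_ne (by omega : b ≠ b + 1),
      Function.update_self, hv, ← hρ]
    funext x
    simp only [Function.update_apply]
    grind
  · funext x
    simp only [Function.update_apply]
    grind

theorem RegComputable.prec {n : ℕ} {f : List.Vector ℕ n → ℕ} {g : List.Vector ℕ (n + 2) → ℕ}
    (hf : RegComputable f) (hg : RegComputable g) :
    RegComputable fun v : List.Vector ℕ (n + 1) =>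
      v.head.rec (f v.tail) fun y IH => g (y ::ᵥ IH ::ᵥ v.tail) := by
  intro ins o b hb hob ho
  refine (((hf (fun i => ins i.succ) o b (fun i => hb _) hob fun i => ho _).seq
    (Realizable.copy (s := ins 0) (o := b) (t := b + 1) (hb 0).ne
      ((hb 0).trans (by omega)).ne (by omega))).seq
    (hg.iterate (fun i => hb i.succ) hob fun i => ho i.succ)).mono ?_
  rintro σ _ ⟨h, hz, rfl⟩
  refine ⟨_, ⟨_, ⟨h, hz, rfl⟩, ?_, ?_, rfl⟩, ?_, fun i => i.rec
    (f (List.Vector.ofFn fun i => σ (ins i.succ))) fun y IH =>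
      g (y ::ᵥ IH ::ᵥ List.Vector.ofFn fun i => σ (ins i.succ)), ?_, fun i => ?_, ?_⟩
  · rw [Function.update_of_ne hob.ne', hz b le_rfl]
  · rw [Function.update_of_ne (by omega), hz _ (by omega)]
  · intro x hx
    rw [Function.update_of_ne hx.ne', Function.update_of_ne (by omega), hz x hx.le]
  · simp [hob.ne]
  · simp [ho, (hb _).ne]
  · funext x
    have := hz b le_rfl
    simp only [Function.update_apply, ho, if_true, if_false, List.Vector.ofFn,
      List.Vector.head_cons, List.Vector.tail_cons]
    split_ifs <;> simp_all

theorem RegComputable.of_primrec' {n : ℕ} {f : List.Vector ℕ n → ℕ} (hf : Nat.Primrec' f) :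
    RegComputable f := by
  induction hf with
  | zero => exact .zero
  | succ => exact .succ
  | get i => exact .get i
  | comp g _ _ hf hg => exact hf.comp hg
  | prec _ _ hf hg => exact hf.prec hg

/-- Register contents with `n`, `k`, `v` in the first three registers and zeros elsewhere. -/
def threeRegs (n k v : ℕ) : ℕ → ℕ := fun r =>
  if r = 0 then n else if r = 1 then k else if r = 2 then v else 0

theorem encodes_threeRegs (n : ℕ) :
    Encodes (threeRegs n 0 1) (Nat.nth Nat.Prime 0 ^ n * Nat.nth Nat.Prime 2, 0) := by
  induction n with
  | zero =>
    have h : Encodes (fun _ => 0) (1, 0) := ⟨one_ne_zero, rfl, by simp⟩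
    convert h.mul 2 using 2
    · funext r
      simp only [threeRegs, Function.update_apply]
      grind
    · ring
  | succ n ih =>
    convert ih.mul 0 using 2
    · funext r
      simp only [threeRegs, Function.update_apply]
      grind
    · ring

theorem stable_of_jump {P : ℕ → Instr} {b : ℕ} (h : P b = .jump b) (z : ℕ × ℕ) :
    Stable (progTrans P) (b, z) := by
  have hstep : step (progTrans P) (b, z) = (b, z) := by
    simp [step, progTrans, h, Instr.next, deltaOf]
  refine ⟨z.1 + z.2, fun t => ?_⟩
  rw [traj, Function.iterate_fixed hstep]
  exact ⟨Nat.le_add_right _ _, Nat.le_add_left _ _⟩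

/-- There is a finite program searching for a zero of `g n`, when started with a counter value
encoding `n`, that is stable exactly if the search succeeds. -/
theorem exists_search_program {g : ℕ → ℕ → ℕ} (hg : Primrec₂ g) :
    ∃ (P : ℕ → Instr) (m : ℕ), 0 < m ∧ (∀ i < m, ∀ b₁ b₂, ((P i).next b₁ b₂).1 < m) ∧
      ∀ n, Stable (progTrans P) (0, Nat.nth Nat.Prime 0 ^ n * Nat.nth Nat.Prime 2, 0) ↔
        ∃ k, g n k = 0 := by
  have hbody := ((Realizable.clear 2).seq (RegComputable.of_primrec' (Nat.Primrec'.prim_iff₂.2 hg)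
    (fun i => i) 2 3 (fun i => by omega) (by omega) fun i => by omega)).seq (.inc 1)
  obtain ⟨b, -, Q, hQ⟩ := hbody.exists_loop 2 0
  let T : ℕ → ℕ := fun i => ∑ b₁ : Bool, ∑ b₂ : Bool, ((Q i).next b₁ b₂).1
  refine ⟨fun i => if i < b then Q i else .jump i, b + 1 + ∑ i ∈ Finset.range b, T i,
    by omega, fun i hi b₁ b₂ => ?_, fun n => ?_⟩
  · dsimp only
    split_ifs with hib
    · have h₁ : T i ≤ ∑ i ∈ Finset.range b, T i :=
        Finset.single_le_sum (fun _ _ => Nat.zero_le _) (Finset.mem_range.2 hib)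
      have h₂ : ((Q i).next b₁ b₂).1 ≤ T i :=
        (Finset.single_le_sum (f := fun b₂ => ((Q i).next b₁ b₂).1)
          (fun _ _ => Nat.zero_le _) (Finset.mem_univ b₂)).trans
          (Finset.single_le_sum (f := fun b₁ => ∑ b₂ : Bool, ((Q i).next b₁ b₂).1)
            (fun _ _ => Nat.zero_le _) (Finset.mem_univ b₁))
      omega
    · exact hi
  set P : ℕ → Instr := fun i => if i < b then Q i else .jump i with hP
  have hloop := hQ P fun i _ hi => if_pos hi
  have hstep : ∀ k v z, v ≠ 0 → Encodes (threeRegs n k v) z →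
      ∃ z', Encodes (threeRegs n (k + 1) (g n k)) z' ∧ Reach P (0, z) (0, z') := by
    intro k v z hv hz
    refine (hloop _ _ hz).2 _ hv ⟨_, ⟨_, rfl, ?_, ?_, rfl⟩, ?_⟩
    · simp
    · intro x hx
      simp [threeRegs, show x ≠ 0 by omega, show x ≠ 1 by omega, show x ≠ 2 by omega]
    · funext x
      simp only [threeRegs, Function.update_apply, List.Vector.ofFn]
      simp
      grind
  have hreach : ∀ k, (∀ j < k, g n j ≠ 0) → ∃ v z, v ≠ 0 ∧ Encodes (threeRegs n k v) z ∧
      Reach P (0, Nat.nth Nat.Prime 0 ^ n * Nat.nth Nat.Prime 2, 0) (0, z) := by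
    intro k
    induction k with
    | zero => exact fun _ => ⟨1, _, one_ne_zero, encodes_threeRegs n, .refl _ _⟩
    | succ k ih =>
      intro h
      obtain ⟨v, z, hv, hz, hr⟩ := ih fun j hj => h j (by omega)
      obtain ⟨z', hz', hr'⟩ := hstep k v z hv hz
      exact ⟨_, z', h k (by omega), hz', hr.trans hr'⟩
  constructor
  · rintro ⟨B, hB⟩
    by_contra! h
    obtain ⟨v, z, -, hz, t, ht⟩ := hreach B fun j _ => h j
    have h₁ := (hB t).1
    rw [ht] at h₁
    have h₂ := Nat.factorization_lt (Nat.nth Nat.Prime 1) hz.1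
    rw [hz.2.2 1] at h₂
    exact absurd h₂ (not_lt.2 h₁)
  · intro h
    obtain ⟨v, z, hv, hz, hr⟩ := hreach (Nat.find h) fun j hj => Nat.find_min h hj
    obtain ⟨z', hz', hr'⟩ := hstep _ v z hv hz
    have hend := (hloop _ _ hz').1 (Nat.find_spec h)
    exact ((hr.trans hr').trans hend).stable_iff.1 (stable_of_jump (by simp [hP]) _)

section ProgramMachine

variable {P : ℕ → Instr} {m : ℕ}

/-- The transitions between the states of `programMachine`. The states below `5 * m` are pairs of
an address of the program and the number of the last increment; the states from `5 * m` on form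
a chain that sets up the first counter. -/
def programNext (P : ℕ → Instr) (m i : ℕ) (b₁ b₂ : Bool) : ℕ :=
  if i < 5 * m then 5 * ((P (i / 5)).next b₁ b₂).1 + ((P (i / 5)).next b₁ b₂).2
  else if i = 5 * m then 0 else i - 1

/-- The increments associated to the states of `programMachine`. -/
def programDelta (m i : ℕ) : ℤ × ℤ := if i < 5 * m then deltaOf (i % 5) else (1, 0)

theorem programNext_lt (hP : ∀ i < m, ∀ b₁ b₂, ((P i).next b₁ b₂).1 < m) {i : ℕ}
    (hi : i < 5 * m) (b₁ b₂ : Bool) : programNext P m i b₁ b₂ < 5 * m := by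
  have h₁ := hP (i / 5) (by omega) b₁ b₂
  have h₂ := (P (i / 5)).next_lt b₁ b₂
  rw [programNext, if_pos hi]
  omega

theorem programNext_lt_of_lt (hP : ∀ i < m, ∀ b₁ b₂, ((P i).next b₁ b₂).1 < m) {N i : ℕ}
    (hi : i < 5 * m + N + 1) (b₁ b₂ : Bool) : programNext P m i b₁ b₂ < 5 * m + N + 1 := by
  by_cases h : i < 5 * m
  · have := programNext_lt hP h b₁ b₂
    omega
  · rw [programNext, if_neg h]
    split_ifs <;> omega

/-- The simplified counter machine that runs the first `m` instructions of the program `P`, with a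
chain of `N + 1` states in front of it. -/
def programMachine (hP : ∀ i < m, ∀ b₁ b₂, ((P i).next b₁ b₂).1 < m) (N : ℕ) :
    Fin (5 * m + N + 1) → Bool → Bool → Fin (5 * m + N + 1) × ℤ × ℤ := fun i b₁ b₂ =>
  (⟨programNext P m i b₁ b₂, programNext_lt_of_lt hP i.2 b₁ b₂⟩,
    programDelta m (programNext P m i b₁ b₂))

theorem isSCM_programMachine (hP : ∀ i < m, ∀ b₁ b₂, ((P i).next b₁ b₂).1 < m)
    (N : ℕ) : IsSCM (programMachine hP N) :=
  ⟨fun i b₁ b₂ => (programMachine hP N i b₁ b₂).1, fun i => programDelta m i, fun _ _ _ => rfl⟩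

theorem programDelta_programNext (hP : ∀ i < m, ∀ b₁ b₂, ((P i).next b₁ b₂).1 < m)
    {i : ℕ} (hi : i < 5 * m) (b₁ b₂ : Bool) :
    programDelta m (programNext P m i b₁ b₂) = deltaOf ((P (i / 5)).next b₁ b₂).2 := by
  have h := programNext_lt hP hi b₁ b₂
  have := (P (i / 5)).next_lt b₁ b₂
  rw [programDelta, if_pos h, programNext, if_pos hi]
  congr 1
  omega

theorem valid_programMachine (hP : ∀ i < m, ∀ b₁ b₂, ((P i).next b₁ b₂).1 < m)
    (N : ℕ) : Valid (programMachine hP N) := by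
  refine ⟨fun i b₁ b₂ => ?_, fun i b₁ b₂ => ?_⟩ <;>
    simp only [programMachine]
  · rw [programDelta]
    split_ifs
    · exact deltaOf_mem _
    · simp [Deltas]
  · by_cases hi : (i : ℕ) < 5 * m
    · rw [programDelta_programNext hP hi]
      exact Instr.next_consistent _ _ _
    · rw [programDelta]
      split_ifs with h
      · have : programNext P m i b₁ b₂ = 0 := by
          rw [programNext, if_neg hi] at h ⊢
          split_ifs at h ⊢ <;> omega
        simp [this, deltaOf]
      · simp

theorem traj_programMachine_chain (hP : ∀ i < m, ∀ b₁ b₂, ((P i).next b₁ b₂).1 < m)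
    {N : ℕ} (hm : 0 < m) (j x : ℕ) (hj : j ≤ N) :
    traj (programMachine hP N) (⟨5 * m + j, by omega⟩, x, 0) (j + 1) =
      (⟨0, by omega⟩, x + j, 0) := by
  induction j generalizing x with
  | zero =>
    simp [traj, step, programMachine, programNext, programDelta, deltaOf, hm]
  | succ j ih =>
    have h := ih (x + 1) (by omega)
    rw [show x + 1 + j = x + (j + 1) by omega] at h
    rw [add_comm (j + 1) 1, traj_add, ← h]
    congr 1
    simp [traj, step, programMachine, programNext, programDelta]

theorem traj_programMachine (hP : ∀ i < m, ∀ b₁ b₂, ((P i).next b₁ b₂).1 < m)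
    (N : ℕ) (hm : 0 < m) (z : ℕ × ℕ) (t : ℕ) :
    ((traj (programMachine hP N) (⟨0, by omega⟩, z) t).1 : ℕ) < 5 * m ∧
      traj (progTrans P) (0, z) t =
        (((traj (programMachine hP N) (⟨0, by omega⟩, z) t).1 : ℕ) / 5,
          (traj (programMachine hP N) (⟨0, by omega⟩, z) t).2) := by
  induction t with
  | zero => exact ⟨by simpa [traj] using hm, by simp [traj]⟩
  | succ t ih =>
    rw [traj_succ, traj_succ, ih.2]
    generalize traj (programMachine hP N) (⟨0, by omega⟩, z) t = c at ih
    refine ⟨programNext_lt hP ih.1 _ _, ?_⟩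
    simp only [step, programMachine, progTrans, programDelta_programNext hP ih.1, Prod.mk.injEq,
      and_true]
    rw [programNext, if_pos ih.1]
    have := (P ((c.1 : ℕ) / 5)).next_lt (decide (0 < c.2.1)) (decide (0 < c.2.2))
    omega

theorem stable_programMachine_iff (hP : ∀ i < m, ∀ b₁ b₂, ((P i).next b₁ b₂).1 < m)
    (N : ℕ) (hm : 0 < m) :
    Stable (programMachine hP N) (Fin.last _, 0, 0) ↔ Stable (progTrans P) (0, N, 0) := by
  rw [← stable_traj_iff _ _ (N + 1)]
  have h := traj_programMachine_chain hP hm N 0 le_rfl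
  rw [zero_add] at h
  rw [show (Fin.last (5 * m + N), 0, 0) = ((⟨5 * m + N, by omega⟩ : Fin (5 * m + N + 1)), 0, 0)
    from rfl, h]
  simp only [Stable, (traj_programMachine hP N hm (N, 0) _).2]

end ProgramMachine

section Encoding

open Encodable

theorem encode_cmStateCode (M : CMStateCode) :
    encode M = Nat.pair M.1 (Nat.pair (encode M.2.1) M.2.2) :=
  rfl

theorem encode_list_map_encode {α : Type*} [Encodable α] (l : List α) :
    encode (l.map (encode : α → ℕ)) = encode l := by
  induction l with
  | nil => rfl
  | cons a l ih => simp [encode_list_cons, ih]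

theorem encode_finPi {m : ℕ} {α : Type*} [Encodable α] (f : Fin m → α) :
    @encode _ (Encodable.finPi m fun _ => α) f =
      encode (List.ofFn fun i => Nat.pair i (encode (f i))) := by
  have h : (List.ofFn fun i : Fin m => Nat.pair i (encode (f i))) =
      (List.ofFn fun i : Fin m => (⟨i, f i⟩ : Σ _ : Fin m, α)).map encode := by
    rw [List.map_ofFn]
    rfl
  rw [h, encode_list_map_encode, ← List.Vector.toList_ofFn]
  rfl

/-- The code of a function on `Bool` in terms of the codes of its values. -/
def boolFunCode (f : Bool → ℕ) : ℕ :=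
  encode (List.ofFn fun i : Fin (Fintype.card Bool) => Nat.pair i (f (fintypeEquivFin.symm i)))

theorem encode_bool_fun {α : Type*} [Encodable α] (f : Bool → α) :
    encode f = boolFunCode fun b => encode (f b) :=
  encode_finPi (f ∘ fintypeEquivFin.symm)

theorem primrec_boolFunCode {α : Type*} [Primcodable α] {f : α → Bool → ℕ}
    (hf : ∀ b, Primrec fun a => f a b) : Primrec fun a => boolFunCode (f a) :=
  Primrec.encode.comp <| Primrec.list_ofFn fun i =>
    Primrec₂.natPair.comp (Primrec.const (i : ℕ)) (hf _)

/-- The part of the code of `programMachine` belonging to the state `i`. -/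
def programEntry (P : ℕ → Instr) (m i : ℕ) : ℕ :=
  boolFunCode fun b₁ => boolFunCode fun b₂ =>
    Nat.pair (programNext P m i b₁ b₂) (encode (programDelta m (programNext P m i b₁ b₂)))

/-- The machine `programMachine` together with its last state. -/
def programCode {P : ℕ → Instr} {m : ℕ} (hP : ∀ i < m, ∀ b₁ b₂, ((P i).next b₁ b₂).1 < m)
    (N : ℕ) : CMStateCode :=
  ⟨5 * m + N + 1, programMachine hP N, Fin.last _⟩

theorem encode_programCode {P : ℕ → Instr} {m : ℕ}
    (hP : ∀ i < m, ∀ b₁ b₂, ((P i).next b₁ b₂).1 < m) (N : ℕ) :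
    encode (programCode hP N) = Nat.pair (5 * m + N + 1) (Nat.pair
      (encode ((List.range (5 * m + N + 1)).map fun i => Nat.pair i (programEntry P m i)))
      (5 * m + N)) := by
  rw [encode_cmStateCode]
  dsimp only [programCode]
  congr 2
  refine (encode_finPi (programMachine hP N)).trans ?_
  rw [List.ofFn_eq_map, ← List.map_coe_finRange_eq_range, List.map_map]
  refine congrArg encode (List.map_congr_left fun i _ => ?_)
  simp only [Function.comp, programEntry, encode_bool_fun]
  rfl

/-- A function agreeing with a primitive recursive one up to finitely many arguments is primitive
recursive. -/
theorem primrec_ite_lt {α : Type*} [Primcodable α] [Inhabited α] (f : ℕ → α) {g : ℕ → α}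
    (hg : Primrec g) (k : ℕ) : Primrec fun i => if i < k then f i else g i := by
  refine (Primrec.ite (Primrec.nat_lt.comp Primrec.id (Primrec.const k))
    ((Primrec.list_getD default).comp (Primrec.const ((List.range k).map f)) Primrec.id)
    hg).of_eq ?_
  intro i
  by_cases h : i < k <;> simp [h]

theorem primrec_programNext (P : ℕ → Instr) (m : ℕ) (b₁ b₂ : Bool) :
    Primrec fun i => programNext P m i b₁ b₂ :=
  primrec_ite_lt _ (Primrec.ite (Primrec.eq.comp Primrec.id (Primrec.const _)) (Primrec.const 0)
    Primrec.pred) _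

theorem primrec_encode_programDelta (m : ℕ) : Primrec fun i => encode (programDelta m i) :=
  (primrec_ite_lt (fun i => encode (deltaOf (i % 5))) (Primrec.const (encode ((1, 0) : ℤ × ℤ)))
    (5 * m)).of_eq fun i => by rw [programDelta]; split_ifs <;> rfl

theorem primrec_programEntry (P : ℕ → Instr) (m : ℕ) : Primrec (programEntry P m) :=
  primrec_boolFunCode fun b₁ => primrec_boolFunCode fun b₂ =>
    Primrec₂.natPair.comp (primrec_programNext P m b₁ b₂)
      ((primrec_encode_programDelta m).comp (primrec_programNext P m b₁ b₂))

theorem primrec_encode_programCode {P : ℕ → Instr} {m : ℕ}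
    (hP : ∀ i < m, ∀ b₁ b₂, ((P i).next b₁ b₂).1 < m) :
    Primrec fun N => encode (programCode hP N) := by
  simp only [encode_programCode]
  have h : Primrec fun N => 5 * m + N := Primrec.nat_add.comp (Primrec.const _) Primrec.id
  have h' : Primrec fun N => 5 * m + N + 1 := Primrec.succ.comp h
  exact Primrec₂.natPair.comp h' <| Primrec₂.natPair.comp
    (Primrec.encode.comp <| Primrec.list_map (Primrec.list_range.comp h')
      (Primrec₂.natPair.comp Primrec.snd ((primrec_programEntry P m).comp Primrec.snd)).to₂) h

end Encoding

theorem primrec_pow_mul (c d : ℕ) : Primrec fun n => c ^ n * d :=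
  (Primrec.nat_rec₁ d (Primrec.nat_mul.comp (Primrec.const c) Primrec.snd).to₂).of_eq fun n => by
    induction n with
    | zero => simp
    | succ n ih =>
      simp only at ih ⊢
      rw [ih]
      ring

theorem exists_primrec_zero_iff_dom : ∃ g : ℕ → ℕ → ℕ, Primrec₂ g ∧
    ∀ c : Nat.Partrec.Code, (∃ k, g (Encodable.encode c) k = 0) ↔ (c.eval 0).Dom := by
  refine ⟨fun n k => bif ((Denumerable.ofNat Nat.Partrec.Code n).evaln k 0 |>.isSome) then 0 else 1,
    ?_, fun c => ?_⟩
  · exact Primrec.cond (Primrec.option_isSome.comp <| Nat.Partrec.Code.primrec_evaln.comp <|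
      ((Primrec.snd.pair ((Primrec.ofNat _).comp Primrec.fst)).pair (Primrec.const 0)))
      (Primrec.const 0) (Primrec.const 1)
  · simp only [Denumerable.ofNat_encode, Part.dom_iff_mem, Nat.Partrec.Code.evaln_complete,
      Option.mem_def]
    rw [exists_comm]
    refine exists_congr fun k => ?_
    rw [← Option.isSome_iff_exists]
    cases (c.evaln k 0).isSome <;> simp

end CM

/-- The stability problem for simplified counter machines with zero initial counters is
undecidable: the set of codes of pairs (simplified counter machine `Γ`, state `s*`) such
that the machine started at `(s*, 0, 0)` is stable is not a computable predicate. -/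
theorem stability_of_simplified_counter_machines_undecidable :
    ¬ ComputablePred (fun n : ℕ =>
      ∃ M : CMStateCode, Encodable.encode M = n ∧ CM.Valid M.2.1 ∧ CM.IsSCM M.2.1 ∧
        CM.Stable M.2.1 (M.2.2, 0, 0)) := by
  intro h
  obtain ⟨g, hg, hdom⟩ := CM.exists_primrec_zero_iff_dom
  obtain ⟨P, m, hm, hP, hstable⟩ := CM.exists_search_program hg
  have hcode : Computable fun c : Nat.Partrec.Code => Encodable.encode (CM.programCode hP
      (Nat.nth Nat.Prime 0 ^ Encodable.encode c * Nat.nth Nat.Prime 2)) :=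
    ((CM.primrec_encode_programCode hP).comp
      ((CM.primrec_pow_mul _ _).comp Primrec.encode)).to_comp
  obtain ⟨_, h⟩ := h
  refine ComputablePred.halting_problem 0 (ComputablePred.of_eq ⟨inferInstance, h.comp hcode⟩
    fun c => ?_)
  rw [← hdom, ← hstable, ← CM.stable_programMachine_iff hP _ hm]
  constructor
  · rintro ⟨M, hM, -, -, hs⟩
    obtain rfl := Encodable.encode_injective hM
    exact hs
  · exact fun hs => ⟨_, rfl, CM.valid_programMachine hP _, CM.isSCM_programMachine hP _, hs⟩
end

section
/- Stability of deterministic multiclass queueing networks under nonpreemptive static buffer priority policies is undecidable: there is no algorithm which, on every input (Q, θ, Q(0)) — Q a deterministic multiclass queueing network with rational interarrival times, delays and service times (possibly zero) and finite or infinite buffer capacities, θ a nonpreemptive static buffer priority scheduling policy, and Q(0) an initial queue-length vector — outputs YES if the triple (Q, θ, Q(0)) is stable and NO otherwise. Formally, the set of codes of stable triples (Q, θ, Q(0)) is not a computable predicate. -/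
open scoped Classical

/-- A deterministic multiclass queueing network together with a nonpreemptive static
buffer priority policy: `J` single-server nodes, `N` job classes, `srv i` the server of
class `i`, `cap i` the buffer capacity of class `i` (`none` meaning `∞`), external
class-`i` arrivals exactly at the times `a i * n + b i`, `n = 0, 1, 2, …` (`a i = none`
meaning no external arrivals), deterministic service time `serv i ≥ 0`, routing
`next i` (the unique class `l` with `R i l = 1`, `none` if row `i` of the 0–1
substochastic routing matrix is zero), and priority rank `prio i` of class `i` within
its server (smaller rank = higher priority). -/
structure MQNet where
  J : ℕ
  N : ℕ
  srv : Fin N → Fin J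
  cap : Fin N → Option ℕ
  a : Fin N → Option ℚ
  b : Fin N → ℚ
  serv : Fin N → ℚ
  next : Fin N → Option (Fin N)
  prio : Fin N → ℕ

namespace MQNet

/-- The state of the network: for each class, the number of jobs waiting in its buffer
(not counting a job in service), and for each server, the class of the job currently in
service together with its remaining work (in grid units of `1/q`), if any. -/
def State (J N : ℕ) : Type := (Fin N → ℕ) × (Fin J → Option (Fin N × ℕ))

variable (net : MQNet)

/-- The denominator of an optional rational (`1` for `none`). -/
def oden : Option ℚ → ℕ
  | none => 1
  | some x => x.den

/-- A common denominator `q` for all the (rational) interarrival times, delays and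
service times of the network: every event in the network happens at a time which is an
integer multiple of `1/q`. -/
def q : ℕ := ∏ i : Fin net.N, ((net.b i).den * (net.serv i).den * oden (net.a i))

/-- The service time of class `i`, measured in grid units of `1/q`. -/
def units (i : Fin net.N) : ℕ := (net.serv i * net.q).num.toNat

/-- Attempt to add one job to the buffer of class `l` (either an external arrival or a
job routed to `l` after a service completion elsewhere): if `cap l = ∞` the job is
always accepted; if `cap l` is finite and positive the job is accepted iff the buffer is
not full; if `cap l = 0` the job is accepted iff the server of `l` is idle and can begin
processing it immediately (no class of that server with strictly higher priority has a
waiting job). A rejected job is dropped from the network. -/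
noncomputable def tryAccept (l : Fin net.N) (st : State net.J net.N) :
    State net.J net.N :=
  match net.cap l with
  | none => (Function.update st.1 l (st.1 l + 1), st.2)
  | some 0 =>
      if st.2 (net.srv l) = none ∧
          ∀ k, net.srv k = net.srv l → net.prio k < net.prio l → st.1 k = 0 then
        (Function.update st.1 l (st.1 l + 1), st.2)
      else st
  | some (c + 1) =>
      if st.1 l < c + 1 then (Function.update st.1 l (st.1 l + 1), st.2) else st

/-- Route a job which has just completed service at class `i`: it joins the class
`next i` (if accepted there), and leaves the network if `next i = none`. -/
noncomputable def routeOne (i : Fin net.N) (st : State net.J net.N) :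
    State net.J net.N :=
  match net.next i with
  | none => st
  | some l => net.tryAccept l st

/-- One grid tick of work at server `j`: the remaining work of the job in service (if
any) decreases by one unit; if it reaches zero the job completes service, is routed to
its next class and the server becomes idle. -/
noncomputable def completionStep (st : State net.J net.N) (j : Fin net.J) :
    State net.J net.N :=
  match st.2 j with
  | none => st
  | some (i, r) =>
      if r ≤ 1 then net.routeOne i (st.1, Function.update st.2 j none)
      else (st.1, Function.update st.2 j (some (i, r - 1)))

/-- The service-completion phase of a grid tick. -/
noncomputable def completionPhase (st : State net.J net.N) : State net.J net.N :=
  (List.finRange net.J).foldl net.completionStep st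

/-- Class `i` has an external arrival at grid time `T` (i.e. at real time `T / q`). -/
def hasArrival (i : Fin net.N) (T : ℕ) : Prop :=
  match net.a i with
  | none => False
  | some x => ∃ n : ℕ, (T : ℚ) = (x * n + net.b i) * net.q

/-- The external-arrival phase of grid tick `T`. -/
noncomputable def arrivalPhase (T : ℕ) (st : State net.J net.N) : State net.J net.N :=
  (List.finRange net.N).foldl
    (fun st i => if net.hasArrival i T then net.tryAccept i st else st) st

/-- One instantaneous event: the lowest-indexed idle server having a nonempty buffer
selects, among its nonempty buffers, the job of the class with highest priority; if the
service time of that class is zero the job completes instantly and is routed onward,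
otherwise its (nonpreemptive) service begins. If there is no such server, nothing
happens. -/
noncomputable def micro (st : State net.J net.N) : State net.J net.N :=
  let idle : Finset (Fin net.J) :=
    Finset.univ.filter fun j => st.2 j = none ∧ ∃ i, net.srv i = j ∧ 0 < st.1 i
  if h : idle.Nonempty then
    let j := Classical.choose (Finset.exists_min_image idle (fun j => (j : ℕ)) h)
    let cands : Finset (Fin net.N) :=
      Finset.univ.filter fun i => net.srv i = j ∧ 0 < st.1 i
    if h2 : cands.Nonempty then
      let i := Classical.choose (Finset.exists_min_image cands net.prio h2)
      if net.units i = 0 then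
        net.routeOne i (Function.update st.1 i (st.1 i - 1), st.2)
      else
        (Function.update st.1 i (st.1 i - 1),
          Function.update st.2 j (some (i, net.units i)))
    else st
  else st

/-- An upper bound on the number of instantaneous events that can happen at a single
time instant (each of the finitely many jobs present can visit at most `N` classes,
since the routing is acyclic). -/
def fuel (st : State net.J net.N) : ℕ :=
  ((∑ i, st.1 i) + net.J + net.N + 2) * (net.N + 2)

/-- The instantaneous-cascade phase: instantaneous events are performed until none is
pending (the fuel bound is large enough for the process to reach a fixed point). -/
noncomputable def microPhase (st : State net.J net.N) : State net.J net.N :=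
  net.micro^[net.fuel st] st

/-- One grid tick `T` of the network dynamics: services in progress advance by one unit
of work and completed jobs are routed; then external arrivals due at tick `T` occur;
then idle servers select new jobs (zero-service jobs being processed and routed
instantly). -/
noncomputable def step (T : ℕ) (st : State net.J net.N) : State net.J net.N :=
  net.microPhase (net.arrivalPhase T (net.completionPhase st))

/-- The state of the network at grid time `T`, starting from the initial queue-length
vector `Q0` at time `0`. Since every interarrival time, delay and service time is an
integer multiple of `1/q`, the queue lengths are constant between consecutive grid
times, so this process carries all the information about the queue-length process in
continuous time. -/
noncomputable def stateAt (Q0 : Fin net.N → ℕ) : ℕ → State net.J net.N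
  | 0 => net.step 0 (Q0, fun _ => none)
  | T + 1 => net.step (T + 1) (stateAt Q0 T)

/-- The total number of jobs in the network in state `st` (jobs waiting in buffers plus
jobs in service). -/
def totalQ (st : State net.J net.N) : ℕ :=
  (∑ i, st.1 i) + (Finset.univ.filter fun j => (st.2 j).isSome).card

/-- Well-formedness of the data: positive interarrival times, nonnegative delays and
service times, the priority ranks define a genuine priority order (a permutation) on the
classes of each server, and the 0–1 substochastic routing matrix has spectral radius
`< 1`, i.e. the routing function is acyclic. -/
def WellFormed : Prop :=
  (∀ i x, net.a i = some x → 0 < x) ∧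
  (∀ i, 0 ≤ net.b i) ∧
  (∀ i, 0 ≤ net.serv i) ∧
  (∀ i k, net.srv i = net.srv k → net.prio i = net.prio k → i = k) ∧
  (∃ rank : Fin net.N → ℕ, ∀ i l, net.next i = some l → rank l < rank i)

/-- The triple (network, priority policy, initial queue lengths) is stable: the total
number of jobs in the network remains bounded in time. -/
def Stable (Q0 : Fin net.N → ℕ) : Prop :=
  ∃ M : ℕ, ∀ T : ℕ, net.totalQ (net.stateAt Q0 T) ≤ M

end MQNet

/-- Codes of triples (network, priority policy, initial queue lengths). -/
def MQNetCode : Type :=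
  Σ J : ℕ, Σ N : ℕ,
    (Fin N → Fin J) × (Fin N → Option ℕ) × (Fin N → Option ℚ) × (Fin N → ℚ) ×
      (Fin N → ℚ) × (Fin N → Option (Fin N)) × (Fin N → ℕ) × (Fin N → ℕ)

instance : Encodable MQNetCode := by unfold MQNetCode; infer_instance

/-- The code (natural number) of a triple (network, priority policy, initial queue
lengths), under a fixed effective encoding. -/
noncomputable def MQNet.code (net : MQNet) (Q0 : Fin net.N → ℕ) : ℕ :=
  Encodable.encode
    (⟨net.J, net.N, (net.srv, net.cap, net.a, net.b, net.serv, net.next, net.prio, Q0)⟩ :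
      MQNetCode)

/-! ### Counter programs -/

/-- Structured counter programs; `loop r p` is `while r ≠ 0 do (r := r - 1; p)`. -/
inductive CounterProg where
  | skip : CounterProg
  | inc : ℕ → CounterProg
  | seq : CounterProg → CounterProg → CounterProg
  | loop : ℕ → CounterProg → CounterProg

namespace CounterProg

open Function

/-- Terminating executions of counter programs. -/
inductive Exec : CounterProg → (ℕ → ℕ) → (ℕ → ℕ) → Prop
  | skip (s : ℕ → ℕ) : Exec skip s s
  | inc (r : ℕ) (s : ℕ → ℕ) : Exec (inc r) s (update s r (s r + 1))
  | seq {p q : CounterProg} {s t u : ℕ → ℕ} : Exec p s t → Exec q t u → Exec (seq p q) s u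
  | loop_zero {r : ℕ} {p : CounterProg} {s : ℕ → ℕ} : s r = 0 → Exec (loop r p) s s
  | loop_succ {r k : ℕ} {p : CounterProg} {s t u : ℕ → ℕ} : s r = k + 1 →
      Exec p (update s r k) t → Exec (loop r p) t u → Exec (loop r p) s u

theorem Exec.congr {p : CounterProg} {s t t' : ℕ → ℕ} (h : Exec p s t) (e : t = t') :
    Exec p s t' := e ▸ h

theorem Exec.loop_family {r : ℕ} {p : CounterProg} (F : ℕ → ℕ → ℕ) (n : ℕ)
    (hr : ∀ k ≤ n, F k r = k) (h : ∀ k < n, Exec p (update (F (k + 1)) r k) (F k)) :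
    Exec (loop r p) (F n) (F 0) := by
  induction n with
  | zero => exact .loop_zero (hr 0 le_rfl)
  | succ n ih =>
    exact .loop_succ (hr (n + 1) le_rfl) (h n (by omega))
      (ih (fun k hk => hr k (by omega)) fun k hk => h k (by omega))

theorem exec_clear (r : ℕ) (s : ℕ → ℕ) : Exec (loop r skip) s (update s r 0) := by
  have := Exec.loop_family (r := r) (p := skip) (fun k => update s r k) (s r) (by simp)
    (fun k _ => by simpa using Exec.skip _)
  simpa using this

theorem exec_move {a c : ℕ} (hac : a ≠ c) (s : ℕ → ℕ) :
    Exec (loop a (inc c)) s (update (update s a 0) c (s c + s a)) := by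
  have := Exec.loop_family (r := a) (p := inc c)
    (fun k => update (update s a k) c (s c + (s a - k))) (s a) (by simp [hac])
    (fun k hk => (Exec.inc _ _).congr (by
      funext x
      by_cases hx : x = c
      · subst hx
        simp [hac.symm]
        omega
      · by_cases hx' : x = a <;> simp [hx, hx', hac]))
  simpa using this

theorem exec_copy {a c d : ℕ} (hac : a ≠ c) (had : a ≠ d) (hcd : c ≠ d) (s : ℕ → ℕ)
    (hd : s d = 0) :
    Exec (seq (loop a (seq (inc c) (inc d))) (loop d (inc a))) s
      (update s c (s c + s a)) := by
  have h := Exec.loop_family (r := a) (p := seq (inc c) (inc d))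
    (fun k => update (update (update s a k) c (s c + (s a - k))) d (s a - k)) (s a)
    (by simp [hac, had])
    (fun k hk => ((Exec.inc _ _).seq (Exec.inc _ _)).congr (by
      funext x
      by_cases hx : x = d
      · subst hx
        simp [hcd.symm, had.symm]
        omega
      · by_cases hx : x = c
        · subst hx
          simp [hac.symm, hcd]
          omega
        · by_cases hx' : x = a <;> simp [*]))
  refine Exec.seq (t := update (update (update s a 0) c (s c + s a)) d (s a))
    (by simpa [show update s d 0 = s from by rw [← hd, update_eq_self]] using h) ((exec_move had.symm _).congr ?_)
  funext x
  by_cases hx : x = a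
  · subst hx
    simp [hac, had]
  · by_cases hx' : x = c
    · subst hx'
      simp [hcd, hx]
    · rcases eq_or_ne x d with rfl | hx'' <;> simp [*]

theorem exists_clear_range (b k : ℕ) :
    ∃ p, ∀ s, Exec p s (fun x => if b ≤ x ∧ x < b + k then 0 else s x) := by
  induction k with
  | zero => exact ⟨skip, fun s => (Exec.skip s).congr (by
      funext x
      rw [if_neg (by omega)])⟩
  | succ k ih =>
    obtain ⟨p, hp⟩ := ih
    refine ⟨seq p (loop (b + k) skip), fun s => ((hp s).seq (exec_clear _ _)).congr ?_⟩
    funext x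
    rcases eq_or_ne x (b + k) with rfl | hx
    · simp
    · rw [update_of_ne hx]
      exact if_congr (by omega) rfl rfl

/-- `f` is computed on the input registers `inp` into the output register `o`, with scratch
registers from `b` on, by a program which leaves all other registers unchanged. -/
def Computes {n : ℕ} (f : List.Vector ℕ n → ℕ) (inp : Fin n → ℕ) (o b : ℕ)
    (p : CounterProg) : Prop :=
  ∀ s : ℕ → ℕ, (∀ x, b ≤ x → s x = 0) → s o = 0 →
    Exec p s (update s o (f (List.Vector.ofFn fun i => s (inp i))))

theorem exists_computes_family {m n : ℕ} {g : Fin n → List.Vector ℕ m → ℕ} {inp : Fin m → ℕ}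
    {b : ℕ} (hin : ∀ i, inp i < b)
    (hg : ∀ i, ∃ p, Computes (g i) inp (b + i) (b + n) p) (k : ℕ) (hk : k ≤ n) :
    ∃ p, ∀ s : ℕ → ℕ, (∀ x, b ≤ x → s x = 0) →
      Exec p s (fun x => if h : b ≤ x ∧ x < b + k then
        g ⟨x - b, by omega⟩ (List.Vector.ofFn fun i => s (inp i)) else s x) := by
  induction k with
  | zero => exact ⟨skip, fun s _ => (Exec.skip s).congr (by
      funext x
      rw [dif_neg (by omega)])⟩
  | succ k ih =>
    obtain ⟨p, hp⟩ := ih (by omega)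
    obtain ⟨q, hq⟩ := hg ⟨k, by omega⟩
    refine ⟨seq p q, fun s hs => ((hp s hs).seq (hq _ ?_ ?_)).congr ?_⟩
    · intro x hx
      rw [dif_neg (by omega)]
      exact hs x (by omega)
    · rw [dif_neg (by simp)]
      exact hs _ (by simp)
    · have e : ∀ i, ¬ (b ≤ inp i ∧ inp i < b + k) := fun i => by
        have := hin i
        omega
      simp only [e, dite_false]
      funext x
      rcases eq_or_ne x (b + k) with rfl | hx
      · simp
      · rw [update_of_ne hx]
        by_cases h : b ≤ x ∧ x < b + k
        · rw [dif_pos h, dif_pos (by omega)]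
        · rw [dif_neg h, dif_neg (by omega)]

theorem exists_computes_prec {n : ℕ} {f : List.Vector ℕ n → ℕ} {g : List.Vector ℕ (n + 2) → ℕ}
    (hf : ∀ (inp : Fin n → ℕ) (o b : ℕ), (∀ i, inp i < b) → o < b → (∀ i, inp i ≠ o) →
      ∃ p, Computes f inp o b p)
    (hg : ∀ (inp : Fin (n + 2) → ℕ) (o b : ℕ), (∀ i, inp i < b) → o < b →
      (∀ i, inp i ≠ o) → ∃ p, Computes g inp o b p)
    (inp : Fin (n + 1) → ℕ) (o b : ℕ) (hin : ∀ i, inp i < b) (ho : o < b)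
    (hne : ∀ i, inp i ≠ o) :
    ∃ p, Computes (fun v : List.Vector ℕ (n + 1) =>
      v.head.rec (f v.tail) fun y IH => g (y ::ᵥ IH ::ᵥ v.tail)) inp o b p := by
  obtain ⟨pf, hpf⟩ := hf (fun i => inp i.succ) o (b + 3) (fun i => (hin _).trans (by omega))
    (by omega) (fun i => hne _)
  obtain ⟨pg, hpg⟩ := hg (Fin.cons (b + 1) (Fin.cons o fun i => inp i.succ)) (b + 2) (b + 3)
    (by
      refine Fin.cases (by simp) (Fin.cases (by simp; omega) fun i => ?_)
      simpa using (hin i.succ).trans (by omega))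
    (by omega)
    (by
      refine Fin.cases (by simp) (Fin.cases (by simp; omega) fun i => ?_)
      simpa using ((hin i.succ).trans (by omega)).ne)
  refine ⟨seq (seq (loop (inp 0) (seq (inc b) (inc (b + 1)))) (loop (b + 1) (inc (inp 0))))
    (seq pf (seq (loop b (seq pg (seq (loop o skip) (seq (loop (b + 2) (inc o)) (inc (b + 1))))))
      (loop (b + 1) skip))), fun s hs hso => ?_⟩
  have hb : s b = 0 := hs _ le_rfl
  have hb1 : s (b + 1) = 0 := hs _ (by omega)
  have hb2 : s (b + 2) = 0 := hs _ (by omega)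
  have h0 := hin 0
  set w : List.Vector ℕ n := List.Vector.ofFn fun i => s (inp i.succ) with hw
  set rec' : ℕ → ℕ := fun k => Nat.rec (f w) (fun y IH => g (y ::ᵥ IH ::ᵥ w)) k with hrec
  have hsucc : ∀ k, rec' (k + 1) = g (k ::ᵥ rec' k ::ᵥ w) := fun k => rfl
  set F : ℕ → ℕ → ℕ := fun k =>
    update (update (update s b k) (b + 1) (s (inp 0) - k)) o (rec' (s (inp 0) - k)) with hF
  refine Exec.seq (exec_copy (by omega) (by omega) (by omega) s hb1) (Exec.seq
    (hpf _ ?_ ?_) (Exec.seq (t := F 0) ?_ ((exec_clear _ _).congr ?_)))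
  · intro x hx
    rw [update_of_ne (by omega)]
    exact hs x (by omega)
  · rw [update_of_ne (by omega)]
    exact hso
  · have := Exec.loop_family (r := b) (p := seq pg (seq (loop o skip)
      (seq (loop (b + 2) (inc o)) (inc (b + 1))))) F (s (inp 0)) ?_ ?_
    · convert this using 1
      funext x
      have e : ∀ i : Fin n, inp i.succ ≠ b := fun i => (hin _).ne
      rcases eq_or_ne x o with rfl | hx
      · simp [hF, hrec, hw, e]
      · rcases eq_or_ne x (b + 1) with rfl | hx1
        · simp [hF, hx, hb1]
        · rcases eq_or_ne x b with rfl | hx2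
          · simp [hF, hx, hb]
          · simp [hF, hx, hx1, hx2]
    · intro k _
      simp [hF, show b ≠ o by omega]
    · intro k hk
      have hob1 : o ≠ b + 1 := by omega
      have hob2 : o ≠ b + 2 := by omega
      have hob : o ≠ b := by omega
      have e : ∀ i : Fin n, inp i.succ ≠ b ∧ inp i.succ ≠ b + 1 ∧ inp i.succ ≠ o := fun i =>
        ⟨(hin _).ne, ((hin _).trans (by omega)).ne, hne _⟩
      refine Exec.congr (Exec.seq (hpg _ ?_ ?_) (Exec.seq (exec_clear _ _) (Exec.seq
        (exec_move hob2.symm _) (Exec.inc _ _)))) ?_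
      · intro x hx
        simp only [hF]
        rw [update_of_ne (by omega), update_of_ne (by omega), update_of_ne (by omega),
          update_of_ne (by omega)]
        exact hs x (by omega)
      · simp [hF, hob2.symm, hb2]
      · have hv : (List.Vector.ofFn fun i : Fin (n + 2) => update (F (k + 1)) b k
            ((Fin.cons (b + 1) (Fin.cons o fun i => inp i.succ) : Fin (n + 2) → ℕ) i)) =
            (s (inp 0) - (k + 1)) ::ᵥ rec' (s (inp 0) - (k + 1)) ::ᵥ w := by
          simp only [List.Vector.ofFn, Fin.cons_zero, Fin.cons_succ, hw]
          congr 1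
          · simp [hF, hob1.symm]
          · congr 1
            · simp [hF, hob]
            · congr 1
              funext i
              simp [hF, e]
        rw [hv, ← hsucc]
        have hk' : s (inp 0) - (k + 1) + 1 = s (inp 0) - k := by omega
        rw [hk']
        funext x
        rcases eq_or_ne x o with rfl | hx
        · simp [hF, hob1, hob2.symm]
        · rcases eq_or_ne x (b + 1) with rfl | hx1
          · simp [hF, hx, hk']
          · rcases eq_or_ne x b with rfl | hx2
            · simp [hF, hx]
            · rcases eq_or_ne x (b + 2) with rfl | hx3
              · simp [hF, hx, hb2]
              · simp [hF, hx, hx1, hx2, hx3]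
  · funext x
    rcases eq_or_ne x o with rfl | hx
    · simp [hF, hrec, hw, show x ≠ b + 1 by omega, List.Vector.ofFn]
    · rcases eq_or_ne x (b + 1) with rfl | hx1
      · simp [hx, hb1]
      · rcases eq_or_ne x b with rfl | hx2
        · simp [hF, hx, hb]
        · simp [hF, hx, hx1, hx2]

theorem exists_computes {n : ℕ} {f : List.Vector ℕ n → ℕ} (hf : Nat.Primrec' f) :
    ∀ (inp : Fin n → ℕ) (o b : ℕ), (∀ i, inp i < b) → o < b → (∀ i, inp i ≠ o) →
      ∃ p, Computes f inp o b p := by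
  induction hf with
  | zero =>
    intro inp o b _ _ _
    exact ⟨skip, fun s _ ho => (Exec.skip s).congr (by simp [← ho])⟩
  | succ =>
    intro inp o b hin ho hne
    refine ⟨seq (seq (loop (inp 0) (seq (inc o) (inc b))) (loop b (inc (inp 0)))) (inc o),
      fun s hs hso => ((exec_copy (hne 0) (hin 0).ne ho.ne s (hs b le_rfl)).seq
        (Exec.inc _ _)).congr ?_⟩
    simp [hso, List.Vector.ofFn]
  | get i =>
    intro inp o b hin ho hne
    refine ⟨seq (loop (inp i) (seq (inc o) (inc b))) (loop b (inc (inp i))),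
      fun s hs hso => (exec_copy (hne i) (hin i).ne ho.ne s (hs b le_rfl)).congr ?_⟩
    simp [hso]
  | @comp m n f g hf hg ihf ihg =>
    intro inp o b hin ho hne
    obtain ⟨pg, hpg⟩ := exists_computes_family (g := g) hin (fun i => ihg i inp (b + i) (b + n)
      (fun j => (hin j).trans_le (by omega)) (by omega)
      (fun j => ((hin j).trans_le (by omega)).ne)) n le_rfl
    obtain ⟨pf, hpf⟩ := ihf (fun i => b + i) o (b + n) (fun i => by omega) (by omega)
      (fun i => by omega)
    obtain ⟨pc, hpc⟩ := exists_clear_range b n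
    refine ⟨seq pg (seq pf pc), fun s hs hso => Exec.congr ((hpg s hs).seq
      ((hpf _ ?_ ?_).seq (hpc _))) ?_⟩
    · intro x hx
      rw [dif_neg (by omega)]
      exact hs x (by omega)
    · rw [dif_neg (by omega)]
      exact hso
    · funext x
      rcases eq_or_ne x o with rfl | hx
      · rw [if_neg (by omega)]
        simp
      · by_cases h : b ≤ x ∧ x < b + n
        · rw [if_pos h, update_of_ne hx, hs x h.1]
        · rw [if_neg h, update_of_ne hx, update_of_ne hx, dif_neg h]
  | prec _ _ ihf ihg =>
    intro inp o b hin ho hne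
    exact exists_computes_prec ihf ihg inp o b hin ho hne

end CounterProg
/-! ### Counter machines -/

/-- A counter machine with set of states `Q` and set of counters `R`. In state `q` it tests
counter `test q`, goes to state `onZero q` if that counter is zero, and otherwise decrements it
and goes to state `onPos q`; then it increments the counter `add q`, if any. The state `none`
is the halting state. -/
structure CounterMachine (Q R : Type) where
  start : Q
  test : Q → R
  onZero : Q → Option Q
  onPos : Q → Option Q
  add : Q → Option R

namespace CounterMachine

open Function

/-- Increment a counter, if any. -/
def bump {R : Type} [DecidableEq R] : Option R → (R → ℕ) → R → ℕ
  | none, c => c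
  | some r, c => update c r (c r + 1)

variable {Q R : Type} [DecidableEq R] (M : CounterMachine Q R)

/-- The state reached from `q` with counters `c`. -/
def target (q : Q) (c : R → ℕ) : Option Q :=
  if c (M.test q) = 0 then M.onZero q else M.onPos q

/-- The counters after the decrement in state `q`. -/
def decr (q : Q) (c : R → ℕ) : R → ℕ :=
  update c (M.test q) (c (M.test q) - 1)

/-- One step of a counter machine. -/
def step : Option Q × (R → ℕ) → Option Q × (R → ℕ)
  | (none, c) => (none, c)
  | (some q, c) => (M.target q c, bump (M.add q) (M.decr q c))

/-- The step relation between non-halted configurations and their successors. -/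
def Step (x y : Option Q × (R → ℕ)) : Prop :=
  ∃ q, x.1 = some q ∧ y = M.step x

/-- The configuration `y` is reachable from `x`. -/
def Reach : Option Q × (R → ℕ) → Option Q × (R → ℕ) → Prop :=
  Relation.ReflTransGen M.Step

variable {M}

theorem Reach.exists_iterate {x y : Option Q × (R → ℕ)} (h : M.Reach x y) :
    ∃ n, M.step^[n] x = y := by
  induction h with
  | refl => exact ⟨0, rfl⟩
  | tail _ h ih =>
    obtain ⟨n, rfl⟩ := ih
    obtain ⟨q, _, rfl⟩ := h
    exact ⟨n + 1, iterate_succ_apply' _ _ _⟩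

variable (M)

/-- Restriction of a machine with counters indexed by `ℕ` to the first `K` counters. -/
def restrict (M : CounterMachine Q ℕ) (K : ℕ) (ht : ∀ q, M.test q < K)
    (ha : ∀ q, ∀ r ∈ M.add q, r < K) : CounterMachine Q (Fin K) where
  start := M.start
  test q := ⟨M.test q, ht q⟩
  onZero := M.onZero
  onPos := M.onPos
  add q := (M.add q).pmap Fin.mk (ha q)

theorem bump_pmap {K : ℕ} (o : Option ℕ) (h : ∀ r ∈ o, r < K) (c : ℕ → ℕ) (i : Fin K) :
    bump (o.pmap Fin.mk h) (fun i : Fin K => c i) i = bump o c i := by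
  cases o <;> simp [bump, update_apply, Fin.ext_iff]

theorem restrict_iterate (M : CounterMachine Q ℕ) (K : ℕ) (ht : ∀ q, M.test q < K)
    (ha : ∀ q, ∀ r ∈ M.add q, r < K) (n : ℕ) (x : Option Q × (ℕ → ℕ)) :
    (M.restrict K ht ha).step^[n] (x.1, fun i => x.2 i) =
      ((M.step^[n] x).1, fun i : Fin K => (M.step^[n] x).2 i) := by
  induction n with
  | zero => rfl
  | succ n ih =>
    rw [iterate_succ_apply', iterate_succ_apply', ih]
    obtain ⟨q | q, c⟩ := M.step^[n] x
    · rfl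
    · refine Prod.ext rfl (funext fun i => ?_)
      have hd : (M.restrict K ht ha).decr q (fun i => c i) = fun i : Fin K => M.decr q c i := by
        funext i
        simp only [decr, restrict, update_apply, Fin.ext_iff]
      simp only [step, hd]
      exact bump_pmap _ _ _ _

end CounterMachine

namespace CounterProg

open Function CounterMachine

/-- The control locations of a counter program. -/
def Pos : CounterProg → Type
  | skip => Unit
  | inc _ => Unit
  | seq p q => Pos p ⊕ Pos q
  | loop _ p => Option (Pos p)

theorem finite_pos : ∀ p : CounterProg, Finite (Pos p)
  | skip => inferInstanceAs (Finite Unit)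
  | inc _ => inferInstanceAs (Finite Unit)
  | seq p q =>
    have := finite_pos p
    have := finite_pos q
    inferInstanceAs (Finite (Pos p ⊕ Pos q))
  | loop _ p =>
    have := finite_pos p
    inferInstanceAs (Finite (Option (Pos p)))

/-- In a sequential composition, leaving the first program means entering the second one. -/
def seqTarget {A B : Type} (b : B) : Option A → Option (A ⊕ B)
  | none => some (.inr b)
  | some a => some (.inl a)

/-- The counter machine of a counter program. Counter `0` of the machine is always zero, and the
counter `r + 1` holds the register `r` of the program. -/
def flat : (p : CounterProg) → CounterMachine (Pos p) ℕ
  | skip => ⟨(), fun _ => 0, fun _ => none, fun _ => none, fun _ => none⟩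
  | inc r => ⟨(), fun _ => 0, fun _ => none, fun _ => none, fun _ => some (r + 1)⟩
  | seq p q =>
    ⟨Sum.inl (flat p).start, Sum.elim (flat p).test (flat q).test,
      Sum.elim (fun a => seqTarget (flat q).start ((flat p).onZero a))
        (fun a => ((flat q).onZero a).map Sum.inr),
      Sum.elim (fun a => seqTarget (flat q).start ((flat p).onPos a))
        (fun a => ((flat q).onPos a).map Sum.inr),
      Sum.elim (flat p).add (flat q).add⟩
  | loop r p =>
    ⟨(none : Option (Pos p)), fun a => Option.elim a (r + 1) (flat p).test,
      fun a => Option.elim a none fun a => some ((flat p).onZero a),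
      fun a => Option.elim a (some (some (flat p).start)) fun a => some ((flat p).onPos a),
      fun a => Option.elim a none (flat p).add⟩

/-- The counters of the machine for given program registers. -/
def counters (s : ℕ → ℕ) : ℕ → ℕ
  | 0 => 0
  | r + 1 => s r

theorem counters_update (s : ℕ → ℕ) (r k : ℕ) :
    counters (update s r k) = update (counters s) (r + 1) k := by
  funext x
  cases x <;> simp [counters, update_apply]

theorem update_counters_zero (s : ℕ → ℕ) : update (counters s) 0 0 = counters s :=
  update_eq_self 0 (counters s)

theorem reach_seq_left {p q : CounterProg} {x y : Option (Pos p) × (ℕ → ℕ)}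
    (h : (flat p).Reach x y) :
    (flat (seq p q)).Reach (seqTarget (flat q).start x.1, x.2)
      (seqTarget (flat q).start y.1, y.2) := by
  refine Relation.ReflTransGen.lift (fun x : Option (Pos p) × (ℕ → ℕ) =>
    ((seqTarget (flat q).start x.1, x.2) : Option (Pos p ⊕ Pos q) × (ℕ → ℕ))) ?_ _ _ h
  rintro ⟨a, c⟩ _ ⟨q', rfl : a = some q', rfl⟩
  refine ⟨Sum.inl q', rfl, ?_⟩
  refine Prod.ext ?_ rfl
  exact (apply_ite (seqTarget (flat q).start) (c ((flat p).test q') = 0) _ _)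

theorem reach_seq_right {p q : CounterProg} {x y : Option (Pos q) × (ℕ → ℕ)}
    (h : (flat q).Reach x y) :
    (flat (seq p q)).Reach (x.1.map Sum.inr, x.2) (y.1.map Sum.inr, y.2) := by
  refine Relation.ReflTransGen.lift (fun x : Option (Pos q) × (ℕ → ℕ) =>
    ((x.1.map Sum.inr, x.2) : Option (Pos p ⊕ Pos q) × (ℕ → ℕ))) ?_ _ _ h
  rintro ⟨a, c⟩ _ ⟨q', rfl : a = some q', rfl⟩
  refine ⟨Sum.inr q', rfl, ?_⟩
  refine Prod.ext ?_ rfl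
  exact (apply_ite (Option.map Sum.inr) (c ((flat q).test q') = 0) _ _)

theorem reach_loop_body {r : ℕ} {p : CounterProg} {x y : Option (Pos p) × (ℕ → ℕ)}
    (h : (flat p).Reach x y) : (flat (loop r p)).Reach (some x.1, x.2) (some y.1, y.2) := by
  refine Relation.ReflTransGen.lift (fun x : Option (Pos p) × (ℕ → ℕ) =>
    ((some x.1, x.2) : Option (Option (Pos p)) × (ℕ → ℕ))) ?_ _ _ h
  rintro ⟨a, c⟩ _ ⟨q', rfl : a = some q', rfl⟩
  refine ⟨some q', rfl, ?_⟩
  refine Prod.ext ?_ rfl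
  exact (apply_ite some (c ((flat p).test q') = 0) _ _)

theorem reach_loop_iteration {r k : ℕ} {p : CounterProg} {s t : ℕ → ℕ} (hs : s r = k + 1)
    (h : (flat p).Reach (some (flat p).start, counters (update s r k)) (none, counters t)) :
    (flat (loop r p)).Reach (some (flat (loop r p)).start, counters s)
      (some (flat (loop r p)).start, counters t) := by
  have e : counters s (r + 1) = k + 1 := hs
  have h' : (flat (loop r p)).step (some (flat (loop r p)).start, counters s) =
      (some (some (flat p).start), counters (update s r k)) := by
    simp [CounterMachine.step, target, decr, flat, bump, e, counters_update]
    rfl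
  exact Relation.ReflTransGen.head ⟨_, rfl, h'.symm⟩ (reach_loop_body (r := r) h)

theorem Exec.reach {p : CounterProg} {s t : ℕ → ℕ} (h : Exec p s t) :
    (flat p).Reach (some (flat p).start, counters s) (none, counters t) := by
  induction h with
  | skip s =>
    refine Relation.ReflTransGen.single ⟨_, rfl, ?_⟩
    simp [CounterMachine.step, target, decr, flat, bump, counters, update_counters_zero]
  | inc r s =>
    refine Relation.ReflTransGen.single ⟨_, rfl, ?_⟩
    simp [CounterMachine.step, target, decr, flat, bump, counters, counters_update,
      update_counters_zero]
  | seq _ _ ih₁ ih₂ => exact (reach_seq_left ih₁).trans (reach_seq_right ih₂)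
  | @loop_zero r p s hs =>
    refine Relation.ReflTransGen.single ⟨_, rfl, ?_⟩
    have e : counters s (r + 1) = 0 := hs
    simp [CounterMachine.step, target, decr, flat, bump, e]
  | loop_succ hs _ _ ih₁ ih₂ => exact (reach_loop_iteration hs ih₁).trans ih₂

end CounterProg

/-- There is a counter machine for which the set of values of counter `1` leading it to halt is
not computable, and such that counter `2` is unbounded in runs that do not halt. -/
theorem CounterMachine.exists_undecidable :
    ∃ (Q : Type) (_ : Finite Q) (M : CounterMachine Q ℕ) (P : ℕ → Prop), ¬ ComputablePred P ∧
      ∀ m, (P m → ∃ n c, M.step^[n] (some M.start, Function.update 0 1 m) = (none, c)) ∧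
        (¬ P m → ∀ k, ∃ n, (M.step^[n] (some M.start, Function.update 0 1 m)).2 2 = k) := by
  open CounterProg Function in
  set f : ℕ → ℕ → ℕ := fun m k =>
    if (Nat.Partrec.Code.evaln k (Denumerable.ofNat Nat.Partrec.Code m) 0).isSome
    then 0 else 1 with hf
  have hfp : Primrec₂ f := by
    have h : Primrec fun a : ℕ × ℕ =>
        Nat.Partrec.Code.evaln a.2 (Denumerable.ofNat Nat.Partrec.Code a.1) 0 :=
      Nat.Partrec.Code.primrec_evaln.comp
        (.pair (.pair .snd ((Primrec.ofNat _).comp .fst)) (.const 0))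
    refine Primrec.of_eq (Primrec.ite ((Primrec.eq (α := Bool)).comp
      (Primrec.option_isSome.comp h) (.const true)) (.const 0) (.const 1)) fun a => ?_
    simp [hf]
  obtain ⟨p, hp⟩ := exists_computes (Nat.Primrec'.prim_iff₂.2 hfp) ![0, 1] 2 3
    (by intro i; fin_cases i <;> simp) (by simp) (by intro i; fin_cases i <;> simp)
  set body := seq p (inc 1) with hbody
  let s : ℕ → ℕ → ℕ → ℕ := fun m k =>
    update (update (update (0 : ℕ → ℕ) 0 m) 1 k) 2 (match k with | 0 => 1 | k + 1 => f m k)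
  have hstart : ∀ m, (flat (seq (inc 2) (loop 2 body))).Reach
      (some (flat (seq (inc 2) (loop 2 body))).start, update 0 1 m)
      (some (Sum.inr (flat (loop 2 body)).start), counters (s m 0)) := by
    intro m
    have := reach_seq_left (q := loop 2 body) (Exec.inc 2 (update (0 : ℕ → ℕ) 0 m)).reach
    have h₁ : counters (update (0 : ℕ → ℕ) 0 m) = update (0 : ℕ → ℕ) 1 m := by
      funext x
      rcases x with _ | _ | x <;> simp [counters]
    have h₂ : update (update (0 : ℕ → ℕ) 0 m) 2 (update (0 : ℕ → ℕ) 0 m 2 + 1) = s m 0 := by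
      funext x
      rcases x with _ | _ | _ | x <;> simp [s]
    rw [h₁, h₂] at this
    exact this
  have hexec : ∀ m k, Exec body (update (s m k) 2 0) (s m (k + 1)) := by
    intro m k
    refine ((hp _ ?_ ?_).seq (Exec.inc _ _)).congr ?_
    · intro x hx
      simp [s, show x ≠ 0 by omega, show x ≠ 1 by omega, show x ≠ 2 by omega]
    · simp
    · funext x
      rcases x with _ | _ | _ | x <;> simp [s, List.Vector.ofFn]
  have hreach : ∀ m k, (∀ j < k, s m j 2 = 1) → (flat (seq (inc 2) (loop 2 body))).Reach
      (some (flat (seq (inc 2) (loop 2 body))).start, update 0 1 m)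
      (some (Sum.inr (flat (loop 2 body)).start), counters (s m k)) := by
    intro m k hk
    induction k with
    | zero => exact hstart m
    | succ k ih =>
      exact (ih fun j hj => hk j (by omega)).trans (reach_seq_right
        (reach_loop_iteration (hk k (by omega)) (hexec m k).reach))
  refine ⟨_, finite_pos _, flat (seq (inc 2) (loop 2 body)), fun m =>
    (Nat.Partrec.Code.eval (Denumerable.ofNat Nat.Partrec.Code m) 0).Dom, ?_, fun m => ⟨?_, ?_⟩⟩
  · intro h
    refine ComputablePred.halting_problem 0 (ComputablePred.computable_of_manyOneReducible
      ⟨Encodable.encode, Computable.encode, fun c => ?_⟩ h)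
    simp
  · intro h
    have hex : ∃ k, s m k 2 = 0 := by
      obtain ⟨k, hk⟩ := Nat.Partrec.Code.evaln_complete.1 (Part.get_mem h)
      refine ⟨k + 1, ?_⟩
      simp only [s, update_self, hf]
      rw [if_pos (Option.isSome_iff_exists.2 ⟨_, hk⟩)]
    have hone : ∀ j < Nat.find hex, s m j 2 = 1 := by
      intro j hj
      have := Nat.find_min hex hj
      rcases j with _ | j
      · simp [s]
      · simp only [s, update_self, hf] at this ⊢
        split_ifs at this ⊢ <;> simp_all
    obtain ⟨n, hn⟩ := Reach.exists_iterate ((hreach m _ hone).trans (reach_seq_right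
      (Exec.loop_zero (p := body) (Nat.find_spec hex)).reach))
    exact ⟨n, _, hn⟩
  · intro h k
    have hone : ∀ j, s m j 2 = 1 := by
      intro j
      rcases j with _ | j
      · simp [s]
      · simp only [s, update_self, hf]
        rw [if_neg]
        intro h'
        obtain ⟨y, hy⟩ := Option.isSome_iff_exists.1 h'
        exact h (Part.dom_iff_mem.2 ⟨y, Nat.Partrec.Code.evaln_complete.2 ⟨_, hy⟩⟩)
    obtain ⟨n, hn⟩ := (hreach m k fun j _ => hone j).exists_iterate
    exact ⟨n, by rw [hn]; simp [counters, s]⟩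
/-! ### One grid tick of a well-behaved network -/

namespace MQNet

open Function

attribute [reducible] State

variable (net : MQNet)

/-- Networks in which no service is instantaneous, all classes with external arrivals have
capacity `0`, all others have capacity `∞`, jobs are routed only to classes without external
arrivals, and every server has at most one class with external arrivals. -/
structure Tame : Prop where
  units_pos : ∀ i, 0 < net.units i
  cap_external : ∀ i, net.a i ≠ none → net.cap i = some 0
  cap_internal : ∀ i, net.a i = none → net.cap i = none
  next_internal : ∀ i l, net.next i = some l → net.a l = none
  external_unique : ∀ i k, net.a i ≠ none → net.a k ≠ none → net.srv i = net.srv k → i = k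
  prio_inj : ∀ i k, net.srv i = net.srv k → net.prio i = net.prio k → i = k

variable {net}

theorem Tame.tryAccept_internal (h : net.Tame) {l : Fin net.N} (hl : net.a l = none)
    (st : State net.J net.N) :
    net.tryAccept l st = (update st.1 l (st.1 l + 1), st.2) := by
  simp [tryAccept, h.cap_internal l hl]

/-- Server `j` completes a job routed to class `l`. -/
def Sends (net : MQNet) (st : State net.J net.N) (j : Fin net.J) (l : Fin net.N) : Prop :=
  ∃ i r, st.2 j = some (i, r) ∧ r ≤ 1 ∧ net.next i = some l

/-- The service in progress at server `j` after the completion phase. -/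
noncomputable def worked (st : State net.J net.N) (j : Fin net.J) : Option (Fin net.N × ℕ) :=
  match st.2 j with
  | none => none
  | some (i, r) => if r ≤ 1 then none else some (i, r - 1)

/-- The queue lengths after the completion phase. -/
noncomputable def mid (st : State net.J net.N) (l : Fin net.N) : ℕ :=
  st.1 l + (Finset.univ.filter fun j => Sends net st j l).card

theorem Tame.foldl_completionStep (h : net.Tame) (st : State net.J net.N)
    (L : List (Fin net.J)) (hL : L.Nodup) :
    L.foldl net.completionStep st =
      (fun l => st.1 l + (L.toFinset.filter fun j => Sends net st j l).card,
        fun j => if j ∈ L then worked st j else st.2 j) := by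
  induction L using List.reverseRecOn with
  | nil => simp
  | append_singleton L j ih =>
    obtain ⟨hL, -, hj⟩ := List.nodup_append.1 hL
    replace hj : j ∉ L := fun h => hj j h j (by simp) rfl
    rw [List.foldl_append, List.foldl_cons, List.foldl_nil, ih hL]
    have hfil : ∀ l, ((L ++ [j]).toFinset.filter fun j => Sends net st j l) =
        if Sends net st j l then insert j (L.toFinset.filter fun j => Sends net st j l)
        else L.toFinset.filter fun j => Sends net st j l := by
      intro l
      ext k
      split_ifs with hs <;> simp <;> grind
    have hcard : ∀ l, ((L ++ [j]).toFinset.filter fun j => Sends net st j l).card =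
        (L.toFinset.filter fun j => Sends net st j l).card +
          if Sends net st j l then 1 else 0 := by
      intro l
      rw [hfil]
      split_ifs
      · rw [Finset.card_insert_of_notMem (by simp [hj])]
      · rfl
    simp only [hcard, completionStep, if_neg hj]
    rcases hst : st.2 j with _ | ⟨i, r⟩
    · refine Prod.ext ?_ (funext fun k => ?_)
      · simp [Sends, hst]
      · by_cases hk : k = j
        · subst hk
          simp [hj, hst, worked]
        · simp [hk]
    · have hw : (fun k => if k ∈ L ++ [j] then worked st k else st.2 k) =
          update (fun k => if k ∈ L then worked st k else st.2 k) j
            (if r ≤ 1 then none else some (i, r - 1)) := by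
        funext k
        by_cases hk : k = j
        · subst hk
          simp [hst, worked]
        · simp [hk]
      rw [hw]
      by_cases hr : r ≤ 1
      · simp only [if_pos hr]
        rcases hn : net.next i with _ | l
        · simp [routeOne, hn, Sends, hst]
        · simp only [routeOne, hn]
          rw [h.tryAccept_internal (h.next_internal i l hn)]
          refine Prod.ext (funext fun k => ?_) rfl
          by_cases hk : k = l
          · subst hk
            simp [Sends, hst, hr, hn]
            ring
          · simp [Sends, hst, hn, hk, Ne.symm hk]
      · simp [hr, Sends, hst]

theorem Tame.completionPhase_eq (h : net.Tame) (st : State net.J net.N) :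
    net.completionPhase st = (mid st, worked st) := by
  rw [completionPhase, h.foldl_completionStep st _ (List.nodup_finRange _)]
  refine Prod.ext (funext fun l => ?_) (by simp)
  simp [mid]

/-- The external arrival at class `i` at time `T`, if any, is accepted. -/
def Admitted (net : MQNet) (T : ℕ) (st : State net.J net.N) (i : Fin net.N) : Prop :=
  net.hasArrival i T ∧ st.2 (net.srv i) = none ∧
    ∀ k, net.srv k = net.srv i → net.prio k < net.prio i → st.1 k = 0

theorem external_of_hasArrival {i : Fin net.N} {T : ℕ} (h : net.hasArrival i T) :
    net.a i ≠ none := by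
  intro h'
  simp [hasArrival, h'] at h

theorem Tame.foldl_arrivals (h : net.Tame) (T : ℕ) (st : State net.J net.N)
    (L : List (Fin net.N)) (hL : L.Nodup) :
    L.foldl (fun st i => if net.hasArrival i T then net.tryAccept i st else st) st =
      (fun i => st.1 i + if i ∈ L ∧ Admitted net T st i then 1 else 0, st.2) := by
  induction L using List.reverseRecOn with
  | nil => simp
  | append_singleton L i ih =>
    obtain ⟨hL, -, hi⟩ := List.nodup_append.1 hL
    replace hi : i ∉ L := fun h => hi i h i (by simp) rfl
    rw [List.foldl_append, List.foldl_cons, List.foldl_nil, ih hL]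
    have hne : ∀ k, (k ∈ L ++ [i] ∧ Admitted net T st k ↔ k ∈ L ∧ Admitted net T st k) ∨
        (k = i ∧ Admitted net T st i) := by
      intro k
      by_cases hk : k = i
      · subst hk
        by_cases ha : Admitted net T st k <;> simp [ha]
      · simp [hk]
    by_cases ha : net.hasArrival i T
    · have hlow : ∀ k, net.srv k = net.srv i → net.prio k < net.prio i →
          ¬ Admitted net T st k := by
        intro k hk hp hk'
        have := h.external_unique k i (external_of_hasArrival hk'.1)
          (external_of_hasArrival ha) hk
        subst this
        exact lt_irrefl _ hp
      have hcond : (st.2 (net.srv i) = none ∧ ∀ k, net.srv k = net.srv i →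
          net.prio k < net.prio i →
            st.1 k + (if k ∈ L ∧ Admitted net T st k then 1 else 0) = 0) ↔
          Admitted net T st i := by
        simp only [Admitted, ha, true_and]
        refine and_congr_right fun _ => forall_congr' fun k => forall_congr' fun hk =>
          forall_congr' fun hp => ?_
        have := hlow k hk hp
        simp only [Admitted] at this
        simp [this]
      simp only [if_pos ha, tryAccept, h.cap_external i (external_of_hasArrival ha), hcond]
      by_cases hadm : Admitted net T st i
      · rw [if_pos hadm]
        refine Prod.ext (funext fun k => ?_) rfl
        by_cases hk : k = i
        · subst hk
          simp [hi, hadm]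
        · simp [hk]
      · rw [if_neg hadm]
        refine Prod.ext (funext fun k => ?_) rfl
        rcases hne k with hk | ⟨_, hk⟩
        · simp only [hk]
        · exact absurd hk hadm
    · rw [if_neg ha]
      refine Prod.ext (funext fun k => ?_) rfl
      rcases hne k with hk | ⟨_, hk⟩
      · simp only [hk]
      · exact absurd hk.1 ha

theorem Tame.arrivalPhase_eq (h : net.Tame) (T : ℕ) (st : State net.J net.N) :
    net.arrivalPhase T st =
      (fun i => st.1 i + if Admitted net T st i then 1 else 0, st.2) := by
  rw [arrivalPhase, h.foldl_arrivals T st _ (List.nodup_finRange _)]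
  simp

/-- The head job of class `i` is selected for service. -/
def Chosen (net : MQNet) (st : State net.J net.N) (i : Fin net.N) : Prop :=
  st.2 (net.srv i) = none ∧ 0 < st.1 i ∧
    ∀ k, net.srv k = net.srv i → net.prio k < net.prio i → st.1 k = 0

theorem Tame.chosen_unique (h : net.Tame) {st : State net.J net.N} {i k : Fin net.N}
    (hi : Chosen net st i) (hk : Chosen net st k) (hs : net.srv k = net.srv i) : k = i := by
  refine h.prio_inj _ _ hs (le_antisymm ?_ ?_)
  · by_contra hlt
    have := hk.2.2 i hs.symm (not_le.1 hlt)
    exact absurd hi.2.1 (by omega)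
  · by_contra hlt
    have := hi.2.2 k hs (not_le.1 hlt)
    exact absurd hk.2.1 (by omega)

/-- All idle servers having work start the service of the chosen jobs. -/
structure Starts (net : MQNet) (st st' : State net.J net.N) : Prop where
  queue : ∀ i, st'.1 i = st.1 i - if Chosen net st i then 1 else 0
  started : ∀ i, Chosen net st i → st'.2 (net.srv i) = some (i, net.units i)
  rest : ∀ j, (∀ i, net.srv i = j → ¬ Chosen net st i) → st'.2 j = st.2 j

/-- The idle servers having work. -/
noncomputable def pending (net : MQNet) (st : State net.J net.N) : Finset (Fin net.J) :=
  Finset.univ.filter fun j => st.2 j = none ∧ ∃ i, net.srv i = j ∧ 0 < st.1 i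

theorem Tame.micro_of_pending (h : net.Tame) {st : State net.J net.N}
    (hp : (pending net st).Nonempty) :
    ∃ i, Chosen net st i ∧ net.micro st =
      (update st.1 i (st.1 i - 1), update st.2 (net.srv i) (some (i, net.units i))) := by
  have hj := (Classical.choose_spec
    (Finset.exists_min_image (pending net st) (fun j => (j : ℕ)) hp)).1
  have hmic : net.micro st = if hp : (pending net st).Nonempty then _ else st := rfl
  rw [dif_pos hp] at hmic
  obtain ⟨-, hidle, k, hk, hk'⟩ := Finset.mem_filter.1 hj
  rw [dif_pos ⟨k, Finset.mem_filter.2 ⟨Finset.mem_univ _, hk, hk'⟩⟩] at hmic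
  have hi := Classical.choose_spec (Finset.exists_min_image (Finset.univ.filter fun i =>
    net.srv i = Classical.choose (Finset.exists_min_image (pending net st)
      (fun j => (j : ℕ)) hp) ∧ 0 < st.1 i) net.prio
        ⟨k, Finset.mem_filter.2 ⟨Finset.mem_univ _, hk, hk'⟩⟩)
  obtain ⟨hi, hmin⟩ := hi
  replace hi := (Finset.mem_filter.1 hi).2
  rw [← hi.1] at hidle
  refine ⟨_, ⟨hidle, hi.2, fun k hk hlt => ?_⟩, hmic.trans ?_⟩
  · by_contra hne
    exact absurd (hmin k (Finset.mem_filter.2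
      ⟨Finset.mem_univ _, hk.trans hi.1, Nat.pos_of_ne_zero hne⟩)) (not_le.2 hlt)
  · exact (if_neg (h.units_pos _).ne').trans (Prod.ext rfl (by rw [hi.1]; rfl))

theorem starts_self {st : State net.J net.N} (hp : pending net st = ∅) :
    Starts net st st := by
  have hno : ∀ i, ¬ Chosen net st i := fun i hi => by
    have : net.srv i ∈ pending net st := by
      simp only [pending, Finset.mem_filter, Finset.mem_univ, true_and]
      exact ⟨hi.1, i, rfl, hi.2.1⟩
    simp [hp] at this
  exact ⟨fun i => by simp [hno], fun i hi => absurd hi (hno i), fun _ _ => rfl⟩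

theorem micro_of_not_pending {st : State net.J net.N} (hp : pending net st = ∅) :
    net.micro st = st :=
  dif_neg (by change ¬ (pending net st).Nonempty; simp [hp])

theorem Tame.starts_of_start (h : net.Tame) {st st' : State net.J net.N} {i : Fin net.N}
    (hi : Chosen net st i) (hs : Starts net (update st.1 i (st.1 i - 1),
      update st.2 (net.srv i) (some (i, net.units i))) st') : Starts net st st' := by
  have hch : ∀ k, Chosen net (update st.1 i (st.1 i - 1),
      update st.2 (net.srv i) (some (i, net.units i))) k ↔ Chosen net st k ∧ k ≠ i := by
    intro k
    by_cases hk : net.srv k = net.srv i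
    · refine iff_of_false (fun hc => ?_) fun hc => hc.2 (h.chosen_unique hi hc.1 hk)
      have := hc.1
      simp [hk] at this
    · have hki : k ≠ i := fun h => hk (h ▸ rfl)
      simp only [Chosen, update_of_ne hk, update_of_ne hki, hki, ne_eq, not_false_eq_true,
        and_true]
      refine and_congr_right fun _ => and_congr_right fun _ => forall_congr' fun l =>
        forall_congr' fun hl => ?_
      rw [update_of_ne]
      rintro rfl
      exact hk hl.symm
  refine ⟨fun k => ?_, fun k hk => ?_, fun j hj => ?_⟩
  · rw [hs.queue, if_congr (hch k) rfl rfl]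
    by_cases hk : k = i
    · subst hk
      simp [hi]
    · simp [hk]
  · by_cases hki : k = i
    · subst hki
      rw [hs.rest _ fun l hl hc => ?_]
      · simp
      · have := hc.1
        simp [hl] at this
    · exact hs.started k ((hch k).2 ⟨hk, hki⟩)
  · have hji : j ≠ net.srv i := fun h => hj i h.symm hi
    rw [hs.rest j fun l hl hc => hj l hl ((hch l).1 hc).1]
    simp [hji]

theorem Tame.starts_iterate (h : net.Tame) (n : ℕ) (st : State net.J net.N)
    (hn : (pending net st).card ≤ n) : Starts net st (net.micro^[n] st) := by
  induction n generalizing st with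
  | zero => exact starts_self (by simpa using hn)
  | succ n ih =>
    rw [iterate_succ_apply]
    rcases (pending net st).eq_empty_or_nonempty with hp | hp
    · rw [micro_of_not_pending hp]
      exact ih st (by simp [hp])
    · obtain ⟨i, hi, hm⟩ := h.micro_of_pending hp
      rw [hm]
      refine h.starts_of_start hi (ih _ ?_)
      have hlt : (pending net (update st.1 i (st.1 i - 1),
          update st.2 (net.srv i) (some (i, net.units i)))).card < (pending net st).card := by
        refine Finset.card_lt_card (Finset.ssubset_iff_of_subset (fun j hj => ?_)|>.2
          ⟨net.srv i, ?_, ?_⟩)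
        · simp only [pending, Finset.mem_filter, Finset.mem_univ, true_and] at hj ⊢
          obtain ⟨hj, k, hk, hpos⟩ := hj
          have hji : j ≠ net.srv i := by
            rintro rfl
            simp at hj
          refine ⟨by simpa [hji] using hj, k, hk, ?_⟩
          rwa [update_of_ne] at hpos
          rintro rfl
          exact hji hk.symm
        · simp only [pending, Finset.mem_filter, Finset.mem_univ, true_and]
          exact ⟨hi.1, i, rfl, hi.2.1⟩
        · simp [pending]
      omega

theorem Tame.starts_microPhase (h : net.Tame) (st : State net.J net.N) :
    Starts net st (net.microPhase st) := by
  refine h.starts_iterate _ st ?_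
  have h₁ : (pending net st).card ≤ net.J := by
    simpa using Finset.card_le_univ (pending net st)
  have h₂ : net.J ≤ net.fuel st := by
    unfold fuel
    nlinarith [Nat.zero_le (∑ i, st.1 i), Nat.zero_le net.N, Nat.zero_le net.J]
  exact h₁.trans h₂

theorem Tame.starts_step (h : net.Tame) (T : ℕ) (st : State net.J net.N) :
    Starts net (fun i => mid st i + if Admitted net T (mid st, worked st) i then 1 else 0,
      worked st) (net.step T st) := by
  have := h.starts_microPhase (net.arrivalPhase T (net.completionPhase st))
  rw [step]
  rwa [h.completionPhase_eq, h.arrivalPhase_eq] at this ⊢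

end MQNet
/-! ### Networks with arbitrary finite sets of servers and classes -/

/-- A queueing network with set of classes `κ`, set of servers `σ` and integer data, where `ext i`
is the pair (period, delay) of the external arrivals at class `i`, and where the classes with
external arrivals have capacity `0` and the other ones have capacity `∞`. -/
structure Layout (κ σ : Type) where
  srv : κ → σ
  ext : κ → Option (ℕ × ℕ)
  units : κ → ℕ
  next : κ → Option κ
  prio : κ → ℕ

namespace Layout

open Function

variable {κ σ : Type} [Fintype κ] [Fintype σ] (L : Layout κ σ)

/-- The conditions on the data making the associated network well-formed and tame. -/
structure Good : Prop where
  units_pos : ∀ i, 0 < L.units i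
  period_pos : ∀ i x, L.ext i = some x → 0 < x.1
  next_internal : ∀ i l, L.next i = some l → L.ext l = none
  external_unique : ∀ i k, L.ext i ≠ none → L.ext k ≠ none → L.srv i = L.srv k → i = k
  prio_inj : ∀ i k, L.srv i = L.srv k → L.prio i = L.prio k → i = k
  acyclic : ∃ rank : κ → ℕ, ∀ i l, L.next i = some l → rank l < rank i

/-- The queueing network of a layout. -/
noncomputable def net : MQNet where
  J := Fintype.card σ
  N := Fintype.card κ
  srv i := Fintype.equivFin σ (L.srv ((Fintype.equivFin κ).symm i))
  cap i := if L.ext ((Fintype.equivFin κ).symm i) = none then none else some 0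
  a i := (L.ext ((Fintype.equivFin κ).symm i)).map fun x => (x.1 : ℚ)
  b i := ((L.ext ((Fintype.equivFin κ).symm i)).map fun x => (x.2 : ℚ)).getD 0
  serv i := (L.units ((Fintype.equivFin κ).symm i) : ℚ)
  next i := (L.next ((Fintype.equivFin κ).symm i)).map (Fintype.equivFin κ)
  prio i := L.prio ((Fintype.equivFin κ).symm i)

/-- The numbering of the classes. -/
noncomputable def cls : κ ≃ Fin L.net.N := Fintype.equivFin κ

/-- The numbering of the servers. -/
noncomputable def svr : σ ≃ Fin L.net.J := Fintype.equivFin σ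

theorem srv_net (i : κ) : L.net.srv (L.cls i) = L.svr (L.srv i) :=
  congrArg (fun i => L.svr (L.srv i)) (L.cls.symm_apply_apply i)

theorem cap_net (i : κ) : L.net.cap (L.cls i) = if L.ext i = none then none else some 0 :=
  congrArg (fun i => if L.ext i = none then none else some 0) (L.cls.symm_apply_apply i)

theorem a_net (i : κ) : L.net.a (L.cls i) = (L.ext i).map fun x => (x.1 : ℚ) :=
  congrArg (fun i => (L.ext i).map fun x : ℕ × ℕ => (x.1 : ℚ)) (L.cls.symm_apply_apply i)

theorem b_net (i : κ) : L.net.b (L.cls i) = ((L.ext i).map fun x => (x.2 : ℚ)).getD 0 :=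
  congrArg (fun i => ((L.ext i).map fun x : ℕ × ℕ => (x.2 : ℚ)).getD 0) (L.cls.symm_apply_apply i)

theorem serv_net (i : κ) : L.net.serv (L.cls i) = L.units i :=
  congrArg (fun i => (L.units i : ℚ)) (L.cls.symm_apply_apply i)

theorem next_net (i : κ) : L.net.next (L.cls i) = (L.next i).map L.cls :=
  congrArg (fun i => (L.next i).map L.cls) (L.cls.symm_apply_apply i)

theorem prio_net (i : κ) : L.net.prio (L.cls i) = L.prio i :=
  congrArg L.prio (L.cls.symm_apply_apply i)

theorem q_net : L.net.q = 1 := by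
  refine Finset.prod_eq_one fun i _ => ?_
  obtain ⟨i, rfl⟩ := L.cls.surjective i
  rw [a_net, b_net, serv_net]
  rcases L.ext i with _ | x <;> simp [MQNet.oden]

theorem units_net (i : κ) : L.net.units (L.cls i) = L.units i := by
  rw [MQNet.units, q_net, serv_net]
  simp

/-- Class `i` has an external arrival at time `T`. -/
def Arrives (i : κ) (T : ℕ) : Prop := ∃ x, L.ext i = some x ∧ ∃ n, T = x.1 * n + x.2

theorem hasArrival_net (i : κ) (T : ℕ) : L.net.hasArrival (L.cls i) T ↔ L.Arrives i T := by
  rw [MQNet.hasArrival, q_net, a_net, b_net, Arrives]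
  rcases L.ext i with _ | x
  · simp
  · simp only [Option.map_some, Option.getD_some, Option.some.injEq, exists_eq_left',
      Nat.cast_one, mul_one]
    exact_mod_cast Iff.rfl

variable {L}

theorem Good.tame (h : L.Good) : L.net.Tame where
  units_pos i := by
    obtain ⟨i, rfl⟩ := L.cls.surjective i
    rw [units_net]
    exact h.units_pos i
  cap_external i hi := by
    obtain ⟨i, rfl⟩ := L.cls.surjective i
    rw [a_net, ne_eq, Option.map_eq_none_iff] at hi
    rw [cap_net, if_neg hi]
  cap_internal i hi := by
    obtain ⟨i, rfl⟩ := L.cls.surjective i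
    rw [a_net, Option.map_eq_none_iff] at hi
    rw [cap_net, if_pos hi]
  next_internal i l hl := by
    obtain ⟨i, rfl⟩ := L.cls.surjective i
    rw [next_net, Option.map_eq_some_iff] at hl
    obtain ⟨l, hl, rfl⟩ := hl
    rw [a_net, h.next_internal _ _ hl, Option.map_none]
  external_unique i k hi hk hs := by
    obtain ⟨i, rfl⟩ := L.cls.surjective i
    obtain ⟨k, rfl⟩ := L.cls.surjective k
    rw [a_net, ne_eq, Option.map_eq_none_iff] at hi hk
    rw [srv_net, srv_net] at hs
    rw [h.external_unique _ _ hi hk (L.svr.injective hs)]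
  prio_inj i k hs hp := by
    obtain ⟨i, rfl⟩ := L.cls.surjective i
    obtain ⟨k, rfl⟩ := L.cls.surjective k
    rw [srv_net, srv_net] at hs
    rw [prio_net, prio_net] at hp
    rw [h.prio_inj _ _ (L.svr.injective hs) hp]

theorem Good.wellFormed (h : L.Good) : L.net.WellFormed := by
  refine ⟨fun i x hx => ?_, fun i => ?_, fun i => ?_, h.tame.prio_inj, ?_⟩
  · obtain ⟨i, rfl⟩ := L.cls.surjective i
    rw [a_net, Option.map_eq_some_iff] at hx
    obtain ⟨x, hx, rfl⟩ := hx
    exact_mod_cast h.period_pos _ _ hx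
  · obtain ⟨i, rfl⟩ := L.cls.surjective i
    rw [b_net]
    rcases L.ext i with _ | x <;> simp
  · obtain ⟨i, rfl⟩ := L.cls.surjective i
    simp [serv_net]
  · obtain ⟨rank, hr⟩ := h.acyclic
    refine ⟨fun i => rank (L.cls.symm i), fun i l hl => ?_⟩
    obtain ⟨i, rfl⟩ := L.cls.surjective i
    rw [next_net, Option.map_eq_some_iff] at hl
    obtain ⟨l, hl, rfl⟩ := hl
    simpa using hr _ _ hl

/-- The states of the network: queue lengths, and services in progress. -/
abbrev St (κ σ : Type) : Type := (κ → ℕ) × (σ → Option (κ × ℕ))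

variable (L) in
/-- The state of the network of a layout corresponding to given data. -/
noncomputable def enc (s : St κ σ) : MQNet.State L.net.J L.net.N :=
  (fun i => s.1 (L.cls.symm i), fun j => (s.2 (L.svr.symm j)).map (Prod.map L.cls id))

theorem enc_fst (s : St κ σ) (i : κ) : (L.enc s).1 (L.cls i) = s.1 i :=
  congrArg s.1 (L.cls.symm_apply_apply i)

theorem enc_snd (s : St κ σ) (j : σ) :
    (L.enc s).2 (L.svr j) = (s.2 j).map (Prod.map L.cls id) :=
  congrArg (fun j => (s.2 j).map (Prod.map L.cls id)) (L.svr.symm_apply_apply j)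

variable (L)

/-- Server `j` completes a job routed to class `l`. -/
def Sends (s : St κ σ) (j : σ) (l : κ) : Prop :=
  ∃ i r, s.2 j = some (i, r) ∧ r ≤ 1 ∧ L.next i = some l

/-- The numbers `m` are the queue lengths after the routing of the completed jobs. -/
def Routed (s : St κ σ) (m : κ → ℕ) : Prop :=
  ∀ l, (m l = s.1 l ∧ ∀ j, ¬ L.Sends s j l) ∨ (m l = s.1 l + 1 ∧ ∃! j, L.Sends s j l)

/-- Server `j` is idle after completions. -/
def Done (s : St κ σ) (j : σ) : Prop := ∀ i r, s.2 j = some (i, r) → r ≤ 1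

/-- The evolution of server `j` and of its queues during the time step `T`, where `m` are the
queue lengths after the routing of completed jobs. -/
inductive Evolves (T : ℕ) (s : St κ σ) (m : κ → ℕ) (s' : St κ σ) (j : σ) : Prop
  | busy (i : κ) (r : ℕ) (h : s.2 j = some (i, r + 2)) (h' : s'.2 j = some (i, r + 1))
      (hq : ∀ k, L.srv k = j → s'.1 k = m k)
  | idle (hd : Done s j) (hm : ∀ k, L.srv k = j → m k = 0 ∧ ¬ L.Arrives k T ∧ s'.1 k = 0)
      (h' : s'.2 j = none)
  | arrive (i : κ) (hd : Done s j) (hi : L.srv i = j) (ha : L.Arrives i T)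
      (hm : ∀ k, L.srv k = j → L.prio k ≤ L.prio i → m k = 0)
      (h' : s'.2 j = some (i, L.units i)) (hq : ∀ k, L.srv k = j → s'.1 k = m k)
  | pick (i : κ) (hd : Done s j) (hi : L.srv i = j) (ha : ¬ L.Arrives i T) (hpos : 0 < m i)
      (hm : ∀ k, L.srv k = j → L.prio k < L.prio i → m k = 0 ∧ ¬ L.Arrives k T)
      (h' : s'.2 j = some (i, L.units i))
      (hq : ∀ k, L.srv k = j → s'.1 k = m k - if k = i then 1 else 0)

variable {L}

theorem sends_enc (s : St κ σ) (j : σ) (l : κ) :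
    L.net.Sends (L.enc s) (L.svr j) (L.cls l) ↔ L.Sends s j l := by
  simp only [MQNet.Sends, Sends, enc_snd, Option.map_eq_some_iff]
  constructor
  · rintro ⟨i, r, ⟨⟨i', r'⟩, h, he⟩, hr, hl⟩
    obtain ⟨rfl, rfl⟩ := Prod.mk.inj he
    rw [next_net, Option.map_eq_some_iff] at hl
    obtain ⟨l', hl, hl'⟩ := hl
    obtain rfl := L.cls.injective hl'
    exact ⟨i', r', h, hr, hl⟩
  · rintro ⟨i, r, h, hr, hl⟩
    exact ⟨L.cls i, r, ⟨_, h, rfl⟩, hr, by rw [next_net, hl]; rfl⟩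

theorem Routed.mid_eq {s : St κ σ} {m : κ → ℕ} (hm : L.Routed s m) (l : κ) :
    MQNet.mid (net := L.net) (L.enc s) (L.cls l) = m l := by
  rw [MQNet.mid, enc_fst]
  rcases hm l with ⟨h, hno⟩ | ⟨h, j, hj, huniq⟩
  · rw [h, Finset.filter_eq_empty_iff.2, Finset.card_empty, add_zero]
    intro j _
    obtain ⟨j, rfl⟩ := L.svr.surjective j
    exact fun hs => hno j ((sends_enc s j l).1 hs)
  · rw [h, add_right_inj, Finset.card_eq_one]
    refine ⟨L.svr j, Finset.eq_singleton_iff_unique_mem.2 ⟨?_, fun k hk => ?_⟩⟩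
    · exact Finset.mem_filter.2 ⟨Finset.mem_univ _, (sends_enc s j l).2 hj⟩
    · obtain ⟨k, rfl⟩ := L.svr.surjective k
      rw [huniq k ((sends_enc s k l).1 (Finset.mem_filter.1 hk).2)]

theorem Done.worked_eq {s : St κ σ} {j : σ} (h : Done s j) :
    MQNet.worked (net := L.net) (L.enc s) (L.svr j) = none := by
  rw [MQNet.worked, enc_snd]
  rcases hs : s.2 j with _ | ⟨i, r⟩
  · rfl
  · exact if_pos (h i r hs)

theorem worked_eq_of_busy {s : St κ σ} {j : σ} {i : κ} {r : ℕ} (h : s.2 j = some (i, r + 2)) :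
    MQNet.worked (net := L.net) (L.enc s) (L.svr j) = some (L.cls i, r + 1) := by
  rw [MQNet.worked, enc_snd, h]
  exact if_neg (by simp)

theorem forall_local {p : Fin L.net.N → Prop} (i : κ) :
    (∀ k, L.net.srv k = L.net.srv (L.cls i) → L.net.prio k < L.net.prio (L.cls i) → p k) ↔
      ∀ k, L.srv k = L.srv i → L.prio k < L.prio i → p (L.cls k) := by
  rw [L.cls.surjective.forall]
  simp only [srv_net, prio_net, EmbeddingLike.apply_eq_iff_eq]

theorem enc_step (h : L.Good) {T : ℕ} {s s' : St κ σ} {m : κ → ℕ} (hm : L.Routed s m)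
    (hs : ∀ j, L.Evolves T s m s' j) : L.net.step T (L.enc s) = L.enc s' := by
  have hst := h.tame.starts_step T (L.enc s)
  set w := MQNet.worked (net := L.net) (L.enc s) with hw
  have hadm : ∀ i, L.net.Admitted T (MQNet.mid (L.enc s), w) (L.cls i) ↔
      L.Arrives i T ∧ w (L.svr (L.srv i)) = none ∧
        ∀ k, L.srv k = L.srv i → L.prio k < L.prio i → m k = 0 := by
    intro i
    rw [MQNet.Admitted, hasArrival_net, forall_local, srv_net]
    simp only [hm.mid_eq]
  generalize hu : (fun i => MQNet.mid (L.enc s) i +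
    if L.net.Admitted T (MQNet.mid (L.enc s), w) i then 1 else 0) = u at hst
  have hload : ∀ i, u (L.cls i) = m i + if L.Arrives i T ∧ w (L.svr (L.srv i)) = none ∧
      (∀ k, L.srv k = L.srv i → L.prio k < L.prio i → m k = 0) then 1 else 0 := by
    intro i
    simp only [← hu, hm.mid_eq, hadm]
  clear hu hadm
  have hqueue : ∀ i, (L.net.step T (L.enc s)).1 i =
      u i - if L.net.Chosen (u, w) i then 1 else 0 := hst.queue
  have hch : ∀ i, L.net.Chosen (u, w) (L.cls i) ↔ w (L.svr (L.srv i)) = none ∧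
      0 < u (L.cls i) ∧ ∀ k, L.srv k = L.srv i → L.prio k < L.prio i → u (L.cls k) = 0 := by
    intro i
    rw [MQNet.Chosen, forall_local, srv_net]
  have key : ∀ j, (L.net.step T (L.enc s)).2 (L.svr j) = (s'.2 j).map (Prod.map L.cls id) ∧
      ∀ k, L.srv k = j → (L.net.step T (L.enc s)).1 (L.cls k) = s'.1 k := by
    intro j
    have hrest : (∀ i, L.srv i = j → ¬ L.net.Chosen (u, w) (L.cls i)) →
        (L.net.step T (L.enc s)).2 (L.svr j) = w (L.svr j) := by
      intro hno
      refine hst.rest _ fun i hi => ?_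
      obtain ⟨i, rfl⟩ := L.cls.surjective i
      rw [srv_net] at hi
      exact hno i (L.svr.injective hi)
    have hsome : ∀ i, L.srv i = j → L.net.Chosen (u, w) (L.cls i) →
        (L.net.step T (L.enc s)).2 (L.svr j) = some (L.cls i, L.units i) := by
      rintro i rfl hi
      rw [← srv_net, hst.started _ hi, units_net]
    have huniq : ∀ i k, L.srv i = j → L.srv k = j → L.net.Chosen (u, w) (L.cls i) →
        (L.net.Chosen (u, w) (L.cls k) ↔ k = i) := by
      rintro i k rfl hk hi
      refine ⟨fun hk' => L.cls.injective (h.tame.chosen_unique hi hk' ?_), fun h => h ▸ hi⟩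
      rw [srv_net, srv_net, hk]
    rcases hs j with ⟨i, r, hj, h', hq⟩ | ⟨hd, hz, h'⟩ | ⟨i, hd, hi, ha, hz, h', hq⟩ |
      ⟨i, hd, hi, ha, hpos, hz, h', hq⟩
    · have hwj : w (L.svr j) = some (L.cls i, r + 1) := worked_eq_of_busy hj
      have hno : ∀ i, L.srv i = j → ¬ L.net.Chosen (u, w) (L.cls i) := by
        rintro i rfl hi
        rw [hch, hwj] at hi
        exact absurd hi.1 (by simp)
      refine ⟨by rw [hrest hno, hwj, h']; rfl, fun k hk => ?_⟩
      rw [hqueue, if_neg (hno k hk), hload, hq k hk, hk, hwj]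
      simp
    · have hwj : w (L.svr j) = none := hd.worked_eq
      have hu : ∀ k, L.srv k = j → u (L.cls k) = 0 := by
        intro k hk
        rw [hload, (hz k hk).1, if_neg fun h => (hz k hk).2.1 h.1]
      have hno : ∀ i, L.srv i = j → ¬ L.net.Chosen (u, w) (L.cls i) := by
        intro i hi hc
        rw [hch, hu i hi] at hc
        exact absurd hc.2.1 (lt_irrefl 0)
      refine ⟨by rw [hrest hno, hwj, h']; rfl, fun k hk => ?_⟩
      rw [hqueue, if_neg (hno k hk), hu k hk, (hz k hk).2.2]
    · have hwj : w (L.svr j) = none := hd.worked_eq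
      have hu : ∀ k, L.srv k = j → u (L.cls k) = m k + if k = i then 1 else 0 := by
        intro k hk
        rw [hload]
        congr 1
        refine if_congr ⟨fun hk' => ?_, ?_⟩ rfl rfl
        · obtain ⟨x, hx, -⟩ := ha
          obtain ⟨⟨y, hy, -⟩, -⟩ := hk'
          exact h.external_unique _ _ (by simp [hy]) (by simp [hx]) (hk.trans hi.symm)
        · rintro rfl
          exact ⟨ha, by rw [hk, hwj], fun l hl hp => hz l (hl.trans hk) hp.le⟩
      have hc : L.net.Chosen (u, w) (L.cls i) := by
        rw [hch]
        refine ⟨by rw [hi, hwj], by rw [hu i hi, if_pos rfl]; omega, fun k hk hp => ?_⟩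
        rw [hu k (hk.trans hi), hz k (hk.trans hi) hp.le, if_neg]
        rintro rfl
        exact lt_irrefl _ hp
      refine ⟨by rw [hsome i hi hc, h']; rfl, fun k hk => ?_⟩
      rw [hqueue, if_congr (huniq i k hi hk hc) rfl rfl, hu k hk, hq k hk]
      omega
    · have hwj : w (L.svr j) = none := hd.worked_eq
      have hu : ∀ k, L.srv k = j → u (L.cls k) = m k := by
        intro k hk
        rw [hload, if_neg, add_zero]
        rintro ⟨hk', -, hk''⟩
        have hki : k ≠ i := fun h => ha (h ▸ hk')
        rcases lt_trichotomy (L.prio k) (L.prio i) with hlt | heq | hlt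
        · exact (hz k hk hlt).2 hk'
        · exact hki (h.prio_inj _ _ (hk.trans hi.symm) heq)
        · exact absurd (hk'' i (hi.trans hk.symm) hlt) hpos.ne'
      have hc : L.net.Chosen (u, w) (L.cls i) := by
        rw [hch]
        refine ⟨by rw [hi, hwj], by rwa [hu i hi], fun k hk hp => ?_⟩
        rw [hu k (hk.trans hi), (hz k (hk.trans hi) hp).1]
      refine ⟨by rw [hsome i hi hc, h']; rfl, fun k hk => ?_⟩
      rw [hqueue, if_congr (huniq i k hi hk hc) rfl rfl, hu k hk, hq k hk]
  refine Prod.ext (funext fun i => ?_) (funext fun j => ?_)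
  · obtain ⟨i, rfl⟩ := L.cls.surjective i
    rw [(key _).2 i rfl, enc_fst]
  · obtain ⟨j, rfl⟩ := L.svr.surjective j
    rw [(key j).1, enc_snd]

end Layout
/-! ### The queueing network of a counter machine -/

/-- The job classes of the network simulating a counter machine. Jobs of class `token r`, waiting
at the server `counter r`, represent the value of counter `r`. A step in state `q` starts with a
job of class `call q` and visits successively `probe q`, `relay q`, `ask q`, `win q`, `lose q`. -/
inductive Job (Q R : Type)
  | hold (r : R)
  | token (r : R)
  | gate (q : Q)
  | block (q : Q)
  | call (q : Q)
  | probe (q : Q)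
  | relay (q : Q)
  | ask (q : Q)
  | win (q : Q)
  | lose (q : Q)

/-- The servers of the network simulating a counter machine. -/
inductive Node (Q R : Type)
  | counter (r : R)
  | door (o : Option Q)
  | caller (q : Q)

instance {Q R : Type} [Finite Q] [Finite R] : Finite (Job Q R) :=
  Finite.of_injective (β := Fin 10 × (Q ⊕ R)) (fun
    | .hold r => (0, .inr r)
    | .token r => (1, .inr r)
    | .gate q => (2, .inl q)
    | .block q => (3, .inl q)
    | .call q => (4, .inl q)
    | .probe q => (5, .inl q)
    | .relay q => (6, .inl q)
    | .ask q => (7, .inl q)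
    | .win q => (8, .inl q)
    | .lose q => (9, .inl q)) (by intro x y; cases x <;> cases y <;> simp)

instance {Q R : Type} [Finite Q] [Finite R] : Finite (Node Q R) :=
  Finite.of_injective (β := R ⊕ Option Q ⊕ Q) (fun
    | .counter r => .inl r
    | .door o => .inr (.inl o)
    | .caller q => .inr (.inr q)) (by intro x y; cases x <;> cases y <;> simp)

namespace CounterMachine

open Function Job Node Layout

variable {Q R : Type} [Fintype Q] (M : CounterMachine Q R)

/-- The network simulating a counter machine. -/
noncomputable def layout : Layout (Job Q R) (Node Q R) where
  srv
    | hold r => counter r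
    | token r => counter r
    | gate q => door (some q)
    | block q => caller q
    | call q => caller q
    | probe q => counter (M.test q)
    | relay q => caller q
    | ask q => counter (M.test q)
    | win q => door (M.onPos q)
    | lose q => door (M.onZero q)
  ext
    | hold _ => some (4, 0)
    | gate _ => some (8, 4)
    | call _ => some (8, 5)
    | _ => none
  units
    | hold _ => 4
    | token _ => 2
    | call _ => 3
    | _ => 1
  next
    | hold _ => none
    | token _ => none
    | gate q => some (block q)
    | block _ => none
    | call q => some (probe q)
    | probe q => some (relay q)
    | relay q => some (ask q)
    | ask q => some (win q)
    | win q => some (lose q)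
    | lose q => (M.add q).map token
  prio
    | hold _ => 2 * Fintype.card Q
    | token _ => 2 * Fintype.card Q + 1
    | gate _ => 2 * Fintype.card Q
    | block _ => 0
    | call _ => 2
    | probe q => Fintype.equivFin Q q
    | relay _ => 1
    | ask q => Fintype.card Q + Fintype.equivFin Q q
    | win q => Fintype.equivFin Q q
    | lose q => Fintype.card Q + Fintype.equivFin Q q

theorem layout_good : M.layout.Good where
  units_pos i := by cases i <;> simp [layout]
  period_pos i x hx := by cases i <;> simp [layout] at hx <;> simp [← hx]
  next_internal i l hl := by
    cases i <;> simp [layout] at hl ⊢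
    all_goals first | simp [← hl] | skip
    obtain ⟨r, -, rfl⟩ := hl
    rfl
  external_unique i k hi hk hs := by
    cases i <;> cases k <;> simp_all [layout]
  prio_inj i k hs hp := by
    have h₁ : ∀ q : Q, (Fintype.equivFin Q q : ℕ) < Fintype.card Q := fun q => Fin.is_lt _
    have h₂ : ∀ q q' : Q, (Fintype.equivFin Q q : ℕ) = Fintype.equivFin Q q' → q = q' :=
      fun q q' h => (Fintype.equivFin Q).injective (Fin.ext h)
    cases i <;> cases k <;> simp only [layout] at hs hp <;> grind
  acyclic := by
    refine ⟨fun
      | hold _ => 0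
      | token _ => 0
      | gate _ => 1
      | block _ => 0
      | call _ => 6
      | probe _ => 5
      | relay _ => 4
      | ask _ => 3
      | win _ => 2
      | lose _ => 1, fun i l hl => ?_⟩
    cases i <;> simp [layout] at hl
    all_goals first | simp [← hl] | skip
    obtain ⟨r, -, rfl⟩ := hl
    simp

variable {M}

theorem arrives_hold (r : R) (T : ℕ) : M.layout.Arrives (hold r) T ↔ T % 8 = 0 ∨ T % 8 = 4 := by
  simp only [Arrives, layout, Option.some.injEq, exists_eq_left']
  exact ⟨fun ⟨n, h⟩ => by omega, fun h => ⟨T / 4, by omega⟩⟩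

theorem arrives_gate (q : Q) (T : ℕ) : M.layout.Arrives (gate q) T ↔ T % 8 = 4 := by
  simp only [Arrives, layout, Option.some.injEq, exists_eq_left']
  exact ⟨fun ⟨n, h⟩ => by omega, fun h => ⟨T / 8, by omega⟩⟩

theorem arrives_call (q : Q) (T : ℕ) : M.layout.Arrives (call q) T ↔ T % 8 = 5 := by
  simp only [Arrives, layout, Option.some.injEq, exists_eq_left']
  exact ⟨fun ⟨n, h⟩ => by omega, fun h => ⟨T / 8, by omega⟩⟩

theorem not_arrives {i : Job Q R} (h : M.layout.ext i = none) (T : ℕ) :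
    ¬ M.layout.Arrives i T := by
  simp [Arrives, h]

end CounterMachine
namespace Layout

variable {κ σ : Type} {L : Layout κ σ}

theorem routed_of_forall_not {s : St κ σ} (h : ∀ j l, ¬ L.Sends s j l) : L.Routed s s.1 :=
  fun l => .inl ⟨rfl, fun j => h j l⟩

theorem routed_of_sends {s : St κ σ} {m : κ → ℕ} (g : κ → Option σ)
    (h : ∀ j l, L.Sends s j l ↔ g l = some j)
    (hm : ∀ l, m l = s.1 l + if (g l).isSome then 1 else 0) : L.Routed s m := by
  intro l
  rcases hg : g l with _ | j
  · refine .inl ⟨by simp [hm, hg], fun j hj => ?_⟩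
    simp [h, hg] at hj
  · refine .inr ⟨by simp [hm, hg], j, (h j l).2 hg, fun j' hj' => ?_⟩
    exact (Option.some.inj (hg.symm.trans ((h j' l).1 hj'))).symm

end Layout

namespace CounterMachine

open Function Job Node Layout

variable {Q R : Type} [Fintype Q] {M : CounterMachine Q R}

@[simp]
theorem arrives_iff (i : Job Q R) (T : ℕ) : M.layout.Arrives i T ↔
    match i with
    | hold _ => T % 8 = 0 ∨ T % 8 = 4
    | gate _ => T % 8 = 4
    | call _ => T % 8 = 5
    | _ => False := by
  cases i with
  | hold r => exact arrives_hold r T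
  | gate q => exact arrives_gate q T
  | call q => exact arrives_call q T
  | _ => exact iff_of_false (not_arrives rfl T) id

@[simp]
theorem layout_units (i : Job Q R) : M.layout.units i =
    match i with
    | hold _ => 4
    | token _ => 2
    | call _ => 3
    | _ => 1 := rfl

@[simp]
theorem layout_next (i : Job Q R) : M.layout.next i =
    match i with
    | hold _ => none
    | token _ => none
    | gate q => some (block q)
    | block _ => none
    | call q => some (probe q)
    | probe q => some (relay q)
    | relay q => some (ask q)
    | ask q => some (win q)
    | win q => some (lose q)
    | lose q => (M.add q).map token := rfl

@[simp]
theorem layout_prio (i : Job Q R) : M.layout.prio i =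
    match i with
    | hold _ => 2 * Fintype.card Q
    | token _ => 2 * Fintype.card Q + 1
    | gate _ => 2 * Fintype.card Q
    | block _ => 0
    | call _ => 2
    | probe q => Fintype.equivFin Q q
    | relay _ => 1
    | ask q => Fintype.card Q + Fintype.equivFin Q q
    | win q => Fintype.equivFin Q q
    | lose q => Fintype.card Q + Fintype.equivFin Q q := rfl

theorem forall_counter {r : R} {p : Job Q R → Prop} :
    (∀ k, M.layout.srv k = counter r → p k) ↔
      p (hold r) ∧ p (token r) ∧ ∀ q, M.test q = r → p (probe q) ∧ p (ask q) := by
  refine ⟨fun h => ⟨h _ rfl, h _ rfl, fun q hq => ⟨h _ (hq ▸ rfl), h _ (hq ▸ rfl)⟩⟩, ?_⟩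
  rintro ⟨h₁, h₂, h₃⟩ k hk
  cases k <;> simp [layout] at hk <;> grind

theorem forall_door {o : Option Q} {p : Job Q R → Prop} :
    (∀ k, M.layout.srv k = door o → p k) ↔
      (∀ q, some q = o → p (gate q)) ∧ (∀ q, M.onPos q = o → p (win q)) ∧
        ∀ q, M.onZero q = o → p (lose q) := by
  refine ⟨fun h => ⟨fun q hq => h _ (hq ▸ rfl), fun q hq => h _ (hq ▸ rfl),
    fun q hq => h _ (hq ▸ rfl)⟩, ?_⟩
  rintro ⟨h₁, h₂, h₃⟩ k hk
  cases k <;> simp [layout] at hk <;> grind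

theorem forall_caller {q : Q} {p : Job Q R → Prop} :
    (∀ k, M.layout.srv k = caller q → p k) ↔ p (block q) ∧ p (call q) ∧ p (relay q) := by
  refine ⟨fun h => ⟨h _ rfl, h _ rfl, h _ rfl⟩, ?_⟩
  rintro ⟨h₁, h₂, h₃⟩ k hk
  cases k <;> simp [layout] at hk <;> grind

/-- The queue lengths representing given values of the counters. -/
@[simp]
def tokens {Q R : Type} (c : R → ℕ) : Job Q R → ℕ
  | token r => c r
  | _ => 0

/-- The state with given queue lengths and given services in progress at the servers. -/
@[simp]
def assemble {Q R : Type} (b : Job Q R → ℕ) (f : R → Option (Job Q R × ℕ))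
    (g : Option Q → Option (Job Q R × ℕ)) (h : Q → Option (Job Q R × ℕ)) :
    St (Job Q R) (Node Q R) :=
  (b, fun
    | counter r => f r
    | door o => g o
    | caller q => h q)

variable (M)

/-- The state `s'` follows the state `s` at time `T`. -/
def Follows (T : ℕ) (s s' : St (Job Q R) (Node Q R)) : Prop :=
  ∃ m, M.layout.Routed s m ∧ ∀ j, M.layout.Evolves T s m s' j

variable {M} [DecidableEq R] {q : Q} {c : R → ℕ} {T : ℕ}

theorem follows_relay_zero (hT : T % 8 = 1) (hc : c (M.test q) = 0) :
    M.Follows T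
      (assemble (tokens c)
        (fun r => some (if r = M.test q then (probe q, 1) else (hold r, 4)))
        (fun _ => none) fun _ => none)
      (assemble (tokens c) (fun r => if r = M.test q then none else some (hold r, 3))
        (fun _ => none) fun q' => if q' = q then some (relay q, 1) else none) := by
  refine ⟨_, routed_of_sends (update (fun _ => none) (relay q) (some (counter (M.test q))))
    ?_ fun l => rfl, ?_⟩
  · rintro (r | o | q') l
    all_goals simp [Sends, update_apply]
    all_goals grind
  · rintro (r | o | q')
    · by_cases hr : r = M.test q
      · subst hr
        refine .idle ?_ (forall_counter.2 ?_) ?_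
        all_goals simp [Done, hT, hc]
      · refine .busy (hold r) 2 ?_ ?_ (forall_counter.2 ?_)
        all_goals simp [hr]
    · refine .idle ?_ (forall_door.2 ?_) ?_
      all_goals simp [Done, hT]
    · by_cases hq : q' = q
      · subst hq
        refine .pick (relay q') ?_ rfl ?_ ?_ (forall_caller.2 ?_) ?_ (forall_caller.2 ?_)
        all_goals simp [Done, hT]
      · refine .idle ?_ (forall_caller.2 ?_) ?_
        all_goals simp [Done, hT, hq]

theorem follows_relay_pos (hT : T % 8 = 1) (hc : c (M.test q) ≠ 0) :
    M.Follows T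
      (assemble (tokens c)
        (fun r => some (if r = M.test q then (probe q, 1) else (hold r, 4)))
        (fun _ => none) fun _ => none)
      (assemble (tokens (M.decr q c))
        (fun r => some (if r = M.test q then (token r, 2) else (hold r, 3)))
        (fun _ => none) fun q' => if q' = q then some (relay q, 1) else none) := by
  refine ⟨_, routed_of_sends (update (fun _ => none) (relay q) (some (counter (M.test q))))
    ?_ fun l => rfl, ?_⟩
  · rintro (r | o | q') l
    all_goals simp [Sends, update_apply]
    all_goals grind
  · rintro (r | o | q')
    · by_cases hr : r = M.test q
      · subst hr
        refine .pick (token (M.test q)) ?_ rfl ?_ ?_ (forall_counter.2 ?_) ?_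
          (forall_counter.2 ?_)
        all_goals simp [Done, hT, decr, Nat.pos_of_ne_zero hc]
      · refine .busy (hold r) 2 ?_ ?_ (forall_counter.2 ?_)
        all_goals simp [hr, decr]
    · refine .idle ?_ (forall_door.2 ?_) ?_
      all_goals simp [Done, hT]
    · by_cases hq : q' = q
      · subst hq
        refine .pick (relay q') ?_ rfl ?_ ?_ (forall_caller.2 ?_) ?_ (forall_caller.2 ?_)
        all_goals simp [Done, hT]
      · refine .idle ?_ (forall_caller.2 ?_) ?_
        all_goals simp [Done, hT, hq]

end CounterMachine
namespace CounterMachine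

open Function Job Node Layout

variable {Q R : Type} [Fintype Q] {M : CounterMachine Q R} [DecidableEq R]
  {q : Q} {c : R → ℕ} {T : ℕ}

theorem follows_ask_zero (hT : T % 8 = 2) (hc : c (M.test q) = 0) :
    M.Follows T
      (assemble (tokens c) (fun r => if r = M.test q then none else some (hold r, 3))
        (fun _ => none) fun q' => if q' = q then some (relay q, 1) else none)
      (assemble (tokens c)
        (fun r => some (if r = M.test q then (ask q, 1) else (hold r, 2)))
        (fun _ => none) fun _ => none) := by
  refine ⟨_, routed_of_sends (update (fun _ => none) (ask q) (some (caller q)))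
    ?_ fun l => rfl, ?_⟩
  · rintro (r | o | q') l
    all_goals simp [Sends, update_apply]
    all_goals grind [tokens]
  · rintro (r | o | q')
    · by_cases hr : r = M.test q
      · subst hr
        refine .pick (ask q) ?_ rfl ?_ ?_ (forall_counter.2 ?_) ?_ (forall_counter.2 ?_)
        all_goals simp [update_apply, Done, hT, hc]
        all_goals grind [tokens]
      · refine .busy (hold r) 1 ?_ ?_ (forall_counter.2 ?_)
        all_goals simp [update_apply, hr]
        all_goals grind [tokens]
    · refine .idle ?_ (forall_door.2 ?_) ?_
      all_goals simp [Done, hT]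
    · refine .idle ?_ (forall_caller.2 ?_) ?_
      all_goals simp [Done, hT]

theorem follows_ask_pos (hT : T % 8 = 2) :
    M.Follows T
      (assemble (tokens c)
        (fun r => some (if r = M.test q then (token r, 2) else (hold r, 3)))
        (fun _ => none) fun q' => if q' = q then some (relay q, 1) else none)
      (assemble (update (tokens c) (ask q) 1)
        (fun r => some (if r = M.test q then (token r, 1) else (hold r, 2)))
        (fun _ => none) fun _ => none) := by
  refine ⟨_, routed_of_sends (update (fun _ => none) (ask q) (some (caller q)))
    ?_ fun l => rfl, ?_⟩
  · rintro (r | o | q') l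
    all_goals simp [Sends, update_apply]
    all_goals grind [tokens]
  · rintro (r | o | q')
    · by_cases hr : r = M.test q
      · subst hr
        refine .busy (token (M.test q)) 0 ?_ ?_ (forall_counter.2 ?_)
        all_goals simp [update_apply]
      · refine .busy (hold r) 1 ?_ ?_ (forall_counter.2 ?_)
        all_goals simp [update_apply, hr]
    · refine .idle ?_ (forall_door.2 ?_) ?_
      all_goals simp [Done, hT]
    · refine .idle ?_ (forall_caller.2 ?_) ?_
      all_goals simp [Done, hT]

theorem follows_win_zero (hT : T % 8 = 3) (hc : c (M.test q) = 0) :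
    M.Follows T
      (assemble (tokens c)
        (fun r => some (if r = M.test q then (ask q, 1) else (hold r, 2)))
        (fun _ => none) fun _ => none)
      (assemble (tokens c) (fun r => if r = M.test q then none else some (hold r, 1))
        (fun o => if o = M.onPos q then some (win q, 1) else none) fun _ => none) := by
  refine ⟨_, routed_of_sends (update (fun _ => none) (win q) (some (counter (M.test q))))
    ?_ fun l => rfl, ?_⟩
  · rintro (r | o | q') l
    all_goals simp [Sends, update_apply]
    all_goals grind [tokens]
  · rintro (r | o | q')
    · by_cases hr : r = M.test q
      · subst hr
        refine .idle ?_ (forall_counter.2 ?_) ?_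
        all_goals simp [Done, hT, hc]
      · refine .busy (hold r) 0 ?_ ?_ (forall_counter.2 ?_)
        all_goals simp [hr]
    · by_cases ho : o = M.onPos q
      · subst ho
        refine .pick (win q) ?_ rfl ?_ ?_ (forall_door.2 ?_) ?_ (forall_door.2 ?_)
        all_goals simp [update_apply, Done, hT]
        all_goals grind [tokens]
      · refine .idle ?_ (forall_door.2 ?_) ?_
        all_goals simp [update_apply, Done, hT, ho]
        all_goals grind [tokens]
    · refine .idle ?_ (forall_caller.2 ?_) ?_
      all_goals simp [Done, hT]

theorem follows_win_pos (hT : T % 8 = 3) :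
    M.Follows T
      (assemble (update (tokens c) (ask q) 1)
        (fun r => some (if r = M.test q then (token r, 1) else (hold r, 2)))
        (fun _ => none) fun _ => none)
      (assemble (tokens c)
        (fun r => some (if r = M.test q then (ask q, 1) else (hold r, 1)))
        (fun _ => none) fun _ => none) := by
  refine ⟨_, routed_of_forall_not ?_, ?_⟩
  · rintro (r | o | q') l
    all_goals simp [Sends]
    all_goals grind [tokens]
  · rintro (r | o | q')
    · by_cases hr : r = M.test q
      · subst hr
        refine .pick (ask q) ?_ rfl ?_ ?_ (forall_counter.2 ?_) ?_ (forall_counter.2 ?_)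
        all_goals simp [update_apply, Done, hT]
        all_goals grind [tokens]
      · refine .busy (hold r) 0 ?_ ?_ (forall_counter.2 ?_)
        all_goals simp [update_apply, hr]
        all_goals grind [tokens]
    · refine .idle ?_ (forall_door.2 ?_) ?_
      all_goals simp [Done, hT]
    · refine .idle ?_ (forall_caller.2 ?_) ?_
      all_goals simp [Done, hT]

theorem follows_gate_zero (hT : T % 8 = 4) :
    M.Follows T
      (assemble (tokens c) (fun r => if r = M.test q then none else some (hold r, 1))
        (fun o => if o = M.onPos q then some (win q, 1) else none) fun _ => none)
      (assemble (tokens c) (fun r => some (hold r, 4))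
        (fun o => if o = M.onZero q then some (lose q, 1) else o.map fun q' => (gate q', 1))
        fun _ => none) := by
  refine ⟨_, routed_of_sends (update (fun _ => none) (lose q) (some (door (M.onPos q))))
    ?_ fun l => rfl, ?_⟩
  · rintro (r | o | q') l
    all_goals simp [Sends, update_apply]
    all_goals grind [tokens]
  · rintro (r | o | q')
    · refine .arrive (hold r) ?_ rfl ?_ (forall_counter.2 ?_) ?_ (forall_counter.2 ?_)
      all_goals simp [Done, hT]
    · by_cases ho : o = M.onZero q
      · subst ho
        refine .pick (lose q) ?_ rfl ?_ ?_ (forall_door.2 ?_) ?_ (forall_door.2 ?_)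
        all_goals simp [update_apply, Done, hT]
        all_goals grind [tokens]
      · rcases o with _ | q'
        · refine .idle ?_ (forall_door.2 ?_) ?_
          all_goals simp [update_apply, Done, hT, ho]
          all_goals grind [tokens]
        · refine .arrive (gate q') ?_ rfl ?_ (forall_door.2 ?_) ?_ (forall_door.2 ?_)
          all_goals simp [update_apply, Done, hT, ho]
          all_goals grind [tokens]
    · refine .idle ?_ (forall_caller.2 ?_) ?_
      all_goals simp [Done, hT]

theorem follows_gate_pos (hT : T % 8 = 4) :
    M.Follows T
      (assemble (tokens c)
        (fun r => some (if r = M.test q then (ask q, 1) else (hold r, 1)))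
        (fun _ => none) fun _ => none)
      (assemble (tokens c) (fun r => some (hold r, 4))
        (fun o => if o = M.onPos q then some (win q, 1) else o.map fun q' => (gate q', 1))
        fun _ => none) := by
  refine ⟨_, routed_of_sends (update (fun _ => none) (win q) (some (counter (M.test q))))
    ?_ fun l => rfl, ?_⟩
  · rintro (r | o | q') l
    all_goals simp [Sends, update_apply]
    all_goals grind [tokens]
  · rintro (r | o | q')
    · refine .arrive (hold r) ?_ rfl ?_ (forall_counter.2 ?_) ?_ (forall_counter.2 ?_)
      all_goals simp [Done, hT]
      all_goals grind [tokens]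
    · by_cases ho : o = M.onPos q
      · subst ho
        refine .pick (win q) ?_ rfl ?_ ?_ (forall_door.2 ?_) ?_ (forall_door.2 ?_)
        all_goals simp [update_apply, Done, hT]
        all_goals grind [tokens]
      · rcases o with _ | q'
        · refine .idle ?_ (forall_door.2 ?_) ?_
          all_goals simp [update_apply, Done, hT, ho]
          all_goals grind [tokens]
        · refine .arrive (gate q') ?_ rfl ?_ (forall_door.2 ?_) ?_ (forall_door.2 ?_)
          all_goals simp [update_apply, Done, hT, ho]
          all_goals grind [tokens]
    · refine .idle ?_ (forall_caller.2 ?_) ?_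
      all_goals simp [Done, hT]

end CounterMachine
namespace CounterMachine

open Function Job Node Layout

variable {Q R : Type} [Fintype Q] {M : CounterMachine Q R} [DecidableEq R]
  {q : Q} {c : R → ℕ} {T : ℕ}

theorem bump_apply (o : Option R) (c : R → ℕ) (r : R) :
    bump o c r = c r + if o = some r then 1 else 0 := by
  rcases o with _ | x <;> simp [bump, update_apply]
  grind

theorem follows_block_zero (hT : T % 8 = 5) :
    M.Follows T
      (assemble (tokens c) (fun r => some (hold r, 4))
        (fun o => if o = M.onZero q then some (lose q, 1) else o.map fun q' => (gate q', 1))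
        fun _ => none)
      (assemble (tokens (bump (M.add q) c)) (fun r => some (hold r, 3)) (fun _ => none)
        fun q' => some (if some q' = M.onZero q then (call q', 3) else (block q', 1))) := by
  refine ⟨_, routed_of_sends (fun
    | block q' => if some q' = M.onZero q then none else some (door (some q'))
    | token r => if M.add q = some r then some (door (M.onZero q)) else none
    | _ => none) ?_ fun l => rfl, ?_⟩
  · rintro (r | o | q') l
    · cases l <;> simp [Sends]
    · by_cases ho : o = M.onZero q
      · subst ho
        cases l <;> simp [Sends]
      · cases o <;> cases l <;> simp [Sends, ho]
        all_goals grind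
    · cases l <;> simp [Sends]
  · rintro (r | o | q')
    · refine .busy (hold r) 2 ?_ ?_ (forall_counter.2 ?_)
      all_goals simp [bump_apply]
    · refine .idle ?_ (forall_door.2 ?_) ?_
      all_goals simp [Done, hT]
      all_goals grind [Option.map_eq_some_iff]
    · by_cases hq : some q' = M.onZero q
      · refine .arrive (call q') ?_ rfl ?_ (forall_caller.2 ?_) ?_ (forall_caller.2 ?_)
        all_goals simp [Done, hT, hq]
      · refine .pick (block q') ?_ rfl ?_ ?_ (forall_caller.2 ?_) ?_ (forall_caller.2 ?_)
        all_goals simp [Done, hT, hq]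

theorem follows_block_pos (hT : T % 8 = 5) :
    M.Follows T
      (assemble (tokens c) (fun r => some (hold r, 4))
        (fun o => if o = M.onPos q then some (win q, 1) else o.map fun q' => (gate q', 1))
        fun _ => none)
      (assemble (tokens c) (fun r => some (hold r, 3))
        (fun o => if o = M.onZero q then some (lose q, 1) else none)
        fun q' => some (if some q' = M.onPos q then (call q', 3) else (block q', 1))) := by
  refine ⟨_, routed_of_sends (fun
    | block q' => if some q' = M.onPos q then none else some (door (some q'))
    | lose q' => if q' = q then some (door (M.onPos q)) else none
    | _ => none) ?_ fun l => rfl, ?_⟩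
  · rintro (r | o | q') l
    · cases l <;> simp [Sends]
    · by_cases ho : o = M.onPos q
      · subst ho
        cases l <;> simp [Sends]
        all_goals grind [Option.map_eq_some_iff]
      · cases o <;> cases l <;> simp [Sends, ho]
        all_goals grind [Option.map_eq_some_iff]
    · cases l <;> simp [Sends]
  · rintro (r | o | q')
    · refine .busy (hold r) 2 ?_ ?_ (forall_counter.2 ?_)
      all_goals simp
    · by_cases ho : o = M.onZero q
      · subst ho
        refine .pick (lose q) ?_ rfl ?_ ?_ (forall_door.2 ?_) ?_ (forall_door.2 ?_)
        all_goals simp [Done, hT]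
        all_goals grind [Option.map_eq_some_iff]
      · refine .idle ?_ (forall_door.2 ?_) ?_
        all_goals simp [Done, hT]
        all_goals grind [Option.map_eq_some_iff]
    · by_cases hq : some q' = M.onPos q
      · refine .arrive (call q') ?_ rfl ?_ (forall_caller.2 ?_) ?_ (forall_caller.2 ?_)
        all_goals simp [Done, hT, hq]
      · refine .pick (block q') ?_ rfl ?_ ?_ (forall_caller.2 ?_) ?_ (forall_caller.2 ?_)
        all_goals simp [Done, hT, hq]

theorem follows_add_zero (hT : T % 8 = 6) (t : Option Q) :
    M.Follows T
      (assemble (tokens c) (fun r => some (hold r, 3)) (fun _ => none)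
        fun q' => some (if some q' = t then (call q', 3) else (block q', 1)))
      (assemble (tokens c) (fun r => some (hold r, 2)) (fun _ => none)
        fun q' => if some q' = t then some (call q', 2) else none) := by
  refine ⟨_, routed_of_forall_not ?_, ?_⟩
  · rintro (r | o | q') l
    all_goals simp [Sends]
    all_goals grind
  · rintro (r | o | q')
    · refine .busy (hold r) 1 ?_ ?_ (forall_counter.2 ?_)
      all_goals simp
    · refine .idle ?_ (forall_door.2 ?_) ?_
      all_goals simp [Done, hT]
    · by_cases hq : some q' = t
      · refine .busy (call q') 1 ?_ ?_ (forall_caller.2 ?_)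
        all_goals simp [hq]
      · refine .idle ?_ (forall_caller.2 ?_) ?_
        all_goals simp [Done, hT, hq]

theorem follows_add_pos (hT : T % 8 = 6) (t : Option Q) :
    M.Follows T
      (assemble (tokens c) (fun r => some (hold r, 3))
        (fun o => if o = M.onZero q then some (lose q, 1) else none)
        fun q' => some (if some q' = t then (call q', 3) else (block q', 1)))
      (assemble (tokens (bump (M.add q) c)) (fun r => some (hold r, 2)) (fun _ => none)
        fun q' => if some q' = t then some (call q', 2) else none) := by
  refine ⟨_, routed_of_sends (fun
    | token r => if M.add q = some r then some (door (M.onZero q)) else none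
    | _ => none) ?_ fun l => rfl, ?_⟩
  · rintro (r | o | q') l
    · cases l <;> simp [Sends]
    · by_cases ho : o = M.onZero q
      · subst ho
        cases l <;> simp [Sends]
      · cases o <;> cases l <;> simp [Sends, ho]
        all_goals grind
    · cases l <;> simp [Sends]
      all_goals grind
  · rintro (r | o | q')
    · refine .busy (hold r) 1 ?_ ?_ (forall_counter.2 ?_)
      all_goals simp [bump_apply]
    · refine .idle ?_ (forall_door.2 ?_) ?_
      all_goals simp [Done, hT]
    · by_cases hq : some q' = t
      · refine .busy (call q') 1 ?_ ?_ (forall_caller.2 ?_)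
        all_goals simp [hq]
      · refine .idle ?_ (forall_caller.2 ?_) ?_
        all_goals simp [Done, hT, hq]

theorem follows_wait (hT : T % 8 = 7) (t : Option Q) :
    M.Follows T
      (assemble (tokens c) (fun r => some (hold r, 2)) (fun _ => none)
        fun q' => if some q' = t then some (call q', 2) else none)
      (assemble (tokens c) (fun r => some (hold r, 1)) (fun _ => none)
        fun q' => if some q' = t then some (call q', 1) else none) := by
  refine ⟨_, routed_of_forall_not ?_, ?_⟩
  · rintro (r | o | q') l
    all_goals simp [Sends]
  · rintro (r | o | q')
    · refine .busy (hold r) 0 ?_ ?_ (forall_counter.2 ?_)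
      all_goals simp
    · refine .idle ?_ (forall_door.2 ?_) ?_
      all_goals simp [Done, hT]
    · by_cases hq : some q' = t
      · refine .busy (call q') 0 ?_ ?_ (forall_caller.2 ?_)
        all_goals simp [hq]
      · refine .idle ?_ (forall_caller.2 ?_) ?_
        all_goals simp [Done, hT, hq]

theorem follows_probe (hT : T % 8 = 0) :
    M.Follows T
      (assemble (tokens c) (fun r => some (hold r, 1)) (fun _ => none)
        fun q' => if some q' = some q then some (call q', 1) else none)
      (assemble (tokens c)
        (fun r => some (if r = M.test q then (probe q, 1) else (hold r, 4)))
        (fun _ => none) fun _ => none) := by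
  refine ⟨_, routed_of_sends (update (fun _ => none) (probe q) (some (caller q)))
    ?_ fun l => rfl, ?_⟩
  · rintro (r | o | q') l
    all_goals simp [Sends, update_apply]
    all_goals grind
  · rintro (r | o | q')
    · by_cases hr : r = M.test q
      · subst hr
        have := (Fintype.equivFin Q q).isLt
        refine .pick (probe q) ?_ rfl ?_ ?_ (forall_counter.2 ?_) ?_ (forall_counter.2 ?_)
        all_goals simp [update_apply, Done, hT]
        all_goals grind
      · refine .arrive (hold r) ?_ rfl ?_ (forall_counter.2 ?_) ?_ (forall_counter.2 ?_)
        all_goals simp [update_apply, Done, hT, hr]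
        all_goals grind
    · refine .idle ?_ (forall_door.2 ?_) ?_
      all_goals simp [Done, hT]
    · refine .idle ?_ (forall_caller.2 ?_) ?_
      all_goals simp [Done, hT]

theorem follows_start (hT : T % 8 = 0) :
    M.Follows T (update (tokens c) (probe q) 1, fun _ => none)
      (assemble (tokens c)
        (fun r => some (if r = M.test q then (probe q, 1) else (hold r, 4)))
        (fun _ => none) fun _ => none) := by
  refine ⟨_, routed_of_forall_not ?_, ?_⟩
  · rintro j l
    simp [Sends]
  · rintro (r | o | q')
    · by_cases hr : r = M.test q
      · subst hr
        have := (Fintype.equivFin Q q).isLt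
        refine .pick (probe q) ?_ rfl ?_ ?_ (forall_counter.2 ?_) ?_ (forall_counter.2 ?_)
        all_goals simp [update_apply, Done, hT]
        all_goals grind
      · refine .arrive (hold r) ?_ rfl ?_ (forall_counter.2 ?_) ?_ (forall_counter.2 ?_)
        all_goals simp [update_apply, Done, hT, hr]
        all_goals grind
    · refine .idle ?_ (forall_door.2 ?_) ?_
      all_goals simp [Done, hT]
    · refine .idle ?_ (forall_caller.2 ?_) ?_
      all_goals simp [Done, hT]

theorem follows_rest (hT : T % 4 ≠ 0) (hT' : T % 8 ≠ 5) (n : ℕ) :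
    M.Follows T
      (assemble (tokens c) (fun r => some (hold r, n + 2)) (fun _ => none) fun _ => none)
      (assemble (tokens c) (fun r => some (hold r, n + 1)) (fun _ => none) fun _ => none) := by
  have hT₀ : T % 8 ≠ 4 := by omega
  refine ⟨_, routed_of_forall_not ?_, ?_⟩
  · rintro (r | o | q') l
    all_goals simp [Sends]
  · rintro (r | o | q')
    · refine .busy (hold r) n ?_ ?_ (forall_counter.2 ?_)
      all_goals simp
    · refine .idle ?_ (forall_door.2 ?_) ?_
      all_goals simp [Done, hT₀]
    · refine .idle ?_ (forall_caller.2 ?_) ?_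
      all_goals simp [Done, hT']

theorem follows_hold (hT : T % 8 = 0) :
    M.Follows T
      (assemble (tokens c) (fun r => some (hold r, 1)) (fun _ => none) fun _ => none)
      (assemble (tokens c) (fun r => some (hold r, 4)) (fun _ => none) fun _ => none) := by
  refine ⟨_, routed_of_forall_not ?_, ?_⟩
  · rintro (r | o | q') l
    all_goals simp [Sends]
  · rintro (r | o | q')
    · refine .arrive (hold r) ?_ rfl ?_ (forall_counter.2 ?_) ?_ (forall_counter.2 ?_)
      all_goals simp [Done, hT]
    · refine .idle ?_ (forall_door.2 ?_) ?_
      all_goals simp [Done, hT]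
    · refine .idle ?_ (forall_caller.2 ?_) ?_
      all_goals simp [Done, hT]

theorem follows_gate_halted (hT : T % 8 = 4) :
    M.Follows T
      (assemble (tokens c) (fun r => some (hold r, 1)) (fun _ => none) fun _ => none)
      (assemble (tokens c) (fun r => some (hold r, 4))
        (fun o => o.map fun q' => (gate q', 1)) fun _ => none) := by
  refine ⟨_, routed_of_forall_not ?_, ?_⟩
  · rintro (r | o | q') l
    all_goals simp [Sends]
  · rintro (r | o | q')
    · refine .arrive (hold r) ?_ rfl ?_ (forall_counter.2 ?_) ?_ (forall_counter.2 ?_)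
      all_goals simp [Done, hT]
    · rcases o with _ | q'
      · refine .idle ?_ (forall_door.2 ?_) ?_
        all_goals simp [Done, hT]
      · refine .arrive (gate q') ?_ rfl ?_ (forall_door.2 ?_) ?_ (forall_door.2 ?_)
        all_goals simp [Done, hT]
    · refine .idle ?_ (forall_caller.2 ?_) ?_
      all_goals simp [Done, hT]

theorem follows_block_halted (hT : T % 8 = 5) :
    M.Follows T
      (assemble (tokens c) (fun r => some (hold r, 4))
        (fun o => o.map fun q' => (gate q', 1)) fun _ => none)
      (assemble (tokens c) (fun r => some (hold r, 3)) (fun _ => none)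
        fun q' => some (if some q' = none then (call q', 3) else (block q', 1))) := by
  refine ⟨_, routed_of_sends (fun
    | block q' => some (door (some q'))
    | _ => none) ?_ fun l => rfl, ?_⟩
  · rintro (r | o | q') l
    · cases l <;> simp [Sends]
    · cases o <;> cases l <;> simp [Sends]
      all_goals grind
    · cases l <;> simp [Sends]
  · rintro (r | o | q')
    · refine .busy (hold r) 2 ?_ ?_ (forall_counter.2 ?_)
      all_goals simp
    · refine .idle ?_ (forall_door.2 ?_) ?_
      all_goals simp [Done, hT]
      all_goals grind
    · refine .pick (block q') ?_ rfl ?_ ?_ (forall_caller.2 ?_) ?_ (forall_caller.2 ?_)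
      all_goals simp [Done, hT]

end CounterMachine
noncomputable instance {Q R : Type} [Finite Q] [Finite R] : Fintype (Job Q R) :=
  Fintype.ofFinite _

noncomputable instance {Q R : Type} [Finite Q] [Finite R] : Fintype (Node Q R) :=
  Fintype.ofFinite _

namespace CounterMachine

open Function Job Node Layout

variable {Q R : Type} [Fintype Q] [Finite R] [DecidableEq R] {M : CounterMachine Q R}

theorem Follows.stateAt_succ {Q0 : Fin M.layout.net.N → ℕ} {T : ℕ} {s s' : St (Job Q R) (Node Q R)}
    (h : M.Follows (T + 1) s s') (hs : M.layout.net.stateAt Q0 T = M.layout.enc s) :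
    M.layout.net.stateAt Q0 (T + 1) = M.layout.enc s' := by
  obtain ⟨m, hm, hj⟩ := h
  rw [MQNet.stateAt, hs, enc_step M.layout_good hm hj]

variable (M) in
/-- The state of the network at the beginning of the simulation of a step of the machine. -/
noncomputable def ready : Option Q × (R → ℕ) → St (Job Q R) (Node Q R)
  | (some q, c) => assemble (tokens c)
      (fun r => some (if r = M.test q then (probe q, 1) else (hold r, 4)))
      (fun _ => none) fun _ => none
  | (none, c) =>
      assemble (tokens c) (fun r => some (hold r, 4)) (fun _ => none) fun _ => none

theorem stateAt_ready_of_add {Q0 : Fin M.layout.net.N → ℕ} {T : ℕ} (hT : T % 8 = 0)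
    {c : R → ℕ} (t : Option Q)
    (h : M.layout.net.stateAt Q0 (T + 6) = M.layout.enc
      (assemble (tokens c) (fun r => some (hold r, 2)) (fun _ => none)
        fun q' => if some q' = t then some (call q', 2) else none)) :
    M.layout.net.stateAt Q0 (T + 8) = M.layout.enc (M.ready (t, c)) := by
  have h₇ := (follows_wait (by omega) t).stateAt_succ h
  rcases t with _ | q
  · refine (follows_hold (by omega)).stateAt_succ (h₇.trans ?_)
    simp only [reduceCtorEq, if_false]
  · exact (follows_probe (by omega)).stateAt_succ h₇

theorem stateAt_ready_succ {Q0 : Fin M.layout.net.N → ℕ} {T : ℕ} (hT : T % 8 = 0)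
    {q : Q} {c : R → ℕ} (h : M.layout.net.stateAt Q0 T = M.layout.enc (M.ready (some q, c))) :
    M.layout.net.stateAt Q0 (T + 8) = M.layout.enc (M.ready (M.step (some q, c))) := by
  refine stateAt_ready_of_add hT _ ?_
  by_cases hc : c (M.test q) = 0
  · have hd : M.decr q c = c := by rw [decr, hc, Nat.zero_sub, ← hc, update_eq_self]
    have ht : M.target q c = M.onZero q := if_pos hc
    rw [hd, ht]
    have h₁ := (follows_relay_zero (by omega) hc).stateAt_succ h
    have h₂ := (follows_ask_zero (by omega) hc).stateAt_succ h₁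
    have h₃ := (follows_win_zero (by omega) hc).stateAt_succ h₂
    have h₄ := (follows_gate_zero (by omega)).stateAt_succ h₃
    have h₅ := (follows_block_zero (by omega)).stateAt_succ h₄
    exact (follows_add_zero (by omega) _).stateAt_succ h₅
  · have ht : M.target q c = M.onPos q := if_neg hc
    rw [ht]
    have h₁ := (follows_relay_pos (by omega) hc).stateAt_succ h
    have h₂ := (follows_ask_pos (by omega)).stateAt_succ h₁
    have h₃ := (follows_win_pos (by omega)).stateAt_succ h₂
    have h₄ := (follows_gate_pos (by omega)).stateAt_succ h₃
    have h₅ := (follows_block_pos (by omega)).stateAt_succ h₄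
    exact (follows_add_pos (by omega) _).stateAt_succ h₅

/-- The successive states of the network after the machine has halted. -/
noncomputable def halted (c : R → ℕ) : ℕ → St (Job Q R) (Node Q R)
  | 0 => assemble (tokens c) (fun r => some (hold r, 4)) (fun _ => none) fun _ => none
  | 1 => assemble (tokens c) (fun r => some (hold r, 3)) (fun _ => none) fun _ => none
  | 2 => assemble (tokens c) (fun r => some (hold r, 2)) (fun _ => none) fun _ => none
  | 3 => assemble (tokens c) (fun r => some (hold r, 1)) (fun _ => none) fun _ => none
  | 4 => assemble (tokens c) (fun r => some (hold r, 4))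
      (fun o => o.map fun q' => (gate q', 1)) fun _ => none
  | 5 => assemble (tokens c) (fun r => some (hold r, 3)) (fun _ => none)
      fun q' => some (block q', 1)
  | 6 => assemble (tokens c) (fun r => some (hold r, 2)) (fun _ => none) fun _ => none
  | _ => assemble (tokens c) (fun r => some (hold r, 1)) (fun _ => none) fun _ => none

theorem follows_halted (c : R → ℕ) (T : ℕ) :
    M.Follows (T + 1) (halted c (T % 8)) (halted c ((T + 1) % 8)) := by
  have h : T % 8 < 8 := Nat.mod_lt _ (by norm_num)
  rw [Nat.add_mod]
  generalize hk : T % 8 = k at h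
  interval_cases k
  · exact follows_rest (by omega) (by omega) 2
  · exact follows_rest (by omega) (by omega) 1
  · exact follows_rest (by omega) (by omega) 0
  · exact follows_gate_halted (by omega)
  · have h := follows_block_halted (M := M) (T := T + 1) (c := c) (by omega)
    simp only [reduceCtorEq, if_false] at h
    exact h
  · have h := follows_add_zero (M := M) (T := T + 1) (c := c) (by omega) none
    simp only [reduceCtorEq, if_false] at h
    exact h
  · exact follows_rest (by omega) (by omega) 0
  · exact follows_hold (by omega)

theorem stateAt_halted {Q0 : Fin M.layout.net.N → ℕ} {n : ℕ} {c : R → ℕ}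
    (h : M.layout.net.stateAt Q0 (8 * n) = M.layout.enc (M.ready (none, c))) (k : ℕ) :
    M.layout.net.stateAt Q0 (8 * n + k) = M.layout.enc (halted c (k % 8)) := by
  induction k with
  | zero => exact h
  | succ k ih =>
    refine Follows.stateAt_succ (T := 8 * n + k) ?_ ih
    simpa [Nat.add_assoc] using follows_halted (M := M) c (8 * n + k)

variable (M) in
/-- The initial queue lengths for given initial values of the counters. -/
noncomputable def initial (c : R → ℕ) (i : Fin M.layout.net.N) : ℕ :=
  update (tokens c) (probe M.start) 1 (M.layout.cls.symm i)

theorem stateAt_initial (c : R → ℕ) (n : ℕ) :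
    M.layout.net.stateAt (M.initial c) (8 * n) =
      M.layout.enc (M.ready (M.step^[n] (some M.start, c))) := by
  induction n with
  | zero =>
    obtain ⟨m, hm, hj⟩ := follows_start (M := M) (q := M.start) (c := c) (Nat.zero_mod 8)
    have h : (M.initial c, fun _ => none) =
        M.layout.enc (update (tokens c) (probe M.start) 1, fun _ => none) := rfl
    rw [Nat.mul_zero, iterate_zero, MQNet.stateAt, h, enc_step M.layout_good hm hj, id]
    rfl
  | succ n ih =>
    rw [iterate_succ_apply']
    generalize M.step^[n] (some M.start, c) = x at ih
    obtain ⟨_ | q, c'⟩ := x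
    · exact stateAt_halted ih 8
    · exact stateAt_ready_succ (Nat.mul_mod_right 8 n) ih

theorem stable_of_halts {c c' : R → ℕ} {n : ℕ}
    (h : M.step^[n] (some M.start, c) = (none, c')) :
    M.layout.net.Stable (M.initial c) := by
  have hn := stateAt_initial (M := M) c n
  rw [h] at hn
  have key : ∀ T, ∃ T' ∈ Finset.range (8 * n + 8), M.layout.net.stateAt (M.initial c) T =
      M.layout.net.stateAt (M.initial c) T' := by
    intro T
    by_cases hT : T < 8 * n
    · exact ⟨T, Finset.mem_range.2 (by omega), rfl⟩
    · refine ⟨8 * n + (T - 8 * n) % 8, Finset.mem_range.2 (by omega), ?_⟩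
      obtain ⟨k, rfl⟩ := Nat.exists_eq_add_of_le (not_lt.1 hT)
      rw [stateAt_halted hn, stateAt_halted hn, Nat.add_sub_cancel_left, Nat.mod_mod]
  refine ⟨(Finset.range (8 * n + 8)).sup fun T =>
    M.layout.net.totalQ (M.layout.net.stateAt (M.initial c) T), fun T => ?_⟩
  obtain ⟨T', hT', h⟩ := key T
  rw [h]
  exact Finset.le_sup (f := fun T =>
    M.layout.net.totalQ (M.layout.net.stateAt (M.initial c) T)) hT'

theorem ready_fst (x : Option Q × (R → ℕ)) : (M.ready x).1 = tokens x.2 := by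
  obtain ⟨_ | q, c⟩ := x <;> rfl

theorem not_stable_of_unbounded {c : R → ℕ} (r : R)
    (h : ∀ k, ∃ n, (M.step^[n] (some M.start, c)).2 r = k) :
    ¬ M.layout.net.Stable (M.initial c) := by
  rintro ⟨B, hB⟩
  obtain ⟨n, hn⟩ := h (B + 1)
  have := hB (8 * n)
  rw [stateAt_initial] at this
  have hle : (M.layout.enc (M.ready (M.step^[n] (some M.start, c)))).1 (M.layout.cls (token r)) ≤
      M.layout.net.totalQ (M.layout.enc (M.ready (M.step^[n] (some M.start, c)))) :=
    (Finset.single_le_sum (f := (M.layout.enc (M.ready (M.step^[n] (some M.start, c)))).1)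
      (fun _ _ => Nat.zero_le _) (Finset.mem_univ _)).trans (Nat.le_add_right _ _)
  rw [enc_fst, ready_fst, tokens, hn] at hle
  omega

end CounterMachine
/-! ### Undecidability -/

theorem Encodable.encode_map {α β : Type*} [Encodable α] [Encodable β] (g : α → β)
    (hg : ∀ x, encode (g x) = encode x) (l : List α) : encode (l.map g) = encode l := by
  induction l with
  | nil => rfl
  | cons x l ih => rw [List.map_cons, encode_list_cons, encode_list_cons, ih, hg]

theorem Encodable.encode_finPi {n : ℕ} (f : Fin n → ℕ) :
    encode f = encode (List.ofFn fun i : Fin n => Nat.pair i (f i)) := by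
  have h : encode f = encode (List.ofFn fun i : Fin n => (⟨i, f i⟩ : Σ _ : Fin n, ℕ)) := by
    change encode (List.Vector.ofFn fun i : Fin n => (⟨i, f i⟩ : Σ _ : Fin n, ℕ)) = _
    rw [← List.Vector.toList_ofFn]
    rfl
  rw [h, ← encode_map (fun x : Σ _ : Fin n, ℕ => Nat.pair x.1 x.2) (fun x => rfl),
    List.map_ofFn]
  rfl

theorem Primrec.encode_finPi {n : ℕ} {f : ℕ → Fin n → ℕ} (hf : ∀ i, Primrec fun m => f m i) :
    Primrec fun m => Encodable.encode (f m) := by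
  simp only [Encodable.encode_finPi]
  exact Primrec.encode.comp (Primrec.list_ofFn fun i =>
    Primrec₂.natPair.comp (.const _) (hf i))

namespace MQNet

theorem code_injective {net net' : MQNet} {Q0 : Fin net.N → ℕ} {Q0' : Fin net'.N → ℕ}
    (h : net.code Q0 = net'.code Q0') : net.Stable Q0 ↔ net'.Stable Q0' := by
  have h' := Encodable.encode_injective h
  obtain ⟨J, N, srv, cap, a, b, serv, next, prio⟩ := net
  obtain ⟨J', N', srv', cap', a', b', serv', next', prio'⟩ := net'
  cases h'
  rfl

theorem code_eq (net : MQNet) (Q0 : Fin net.N → ℕ) :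
    net.code Q0 = Nat.pair net.J (Nat.pair net.N (Nat.pair (Encodable.encode net.srv)
      (Nat.pair (Encodable.encode net.cap) (Nat.pair (Encodable.encode net.a)
        (Nat.pair (Encodable.encode net.b) (Nat.pair (Encodable.encode net.serv)
          (Nat.pair (Encodable.encode net.next) (Nat.pair (Encodable.encode net.prio)
            (Encodable.encode Q0))))))))) := by
  refine (Encodable.encode_sigma_val _ _).trans (congrArg (Nat.pair _) ?_)
  refine (Encodable.encode_sigma_val _ _).trans (congrArg (Nat.pair _) ?_)
  simp only [Encodable.encode_prod_val]

theorem primrec_code (net : MQNet) {f : ℕ → Fin net.N → ℕ} (hf : ∀ i, Primrec fun m => f m i) :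
    Primrec fun m => net.code (f m) := by
  have h := Primrec.encode_finPi hf
  simp only [code_eq]
  exact Primrec₂.natPair.comp (.const _) (Primrec₂.natPair.comp (.const _)
    (Primrec₂.natPair.comp (.const _) (Primrec₂.natPair.comp (.const _)
    (Primrec₂.natPair.comp (.const _) (Primrec₂.natPair.comp (.const _)
    (Primrec₂.natPair.comp (.const _) (Primrec₂.natPair.comp (.const _)
    (Primrec₂.natPair.comp (.const _) h))))))))

end MQNet


/-- Stability of deterministic multiclass queueing networks under nonpreemptive static
buffer priority policies is undecidable: the set of codes of stable triples
`(Q, θ, Q(0))` is not a computable predicate. -/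
theorem stability_of_queueing_networks_undecidable :
    ¬ ComputablePred (fun n : ℕ =>
      ∃ (net : MQNet) (Q0 : Fin net.N → ℕ),
        net.code Q0 = n ∧ net.WellFormed ∧ net.Stable Q0) := by
  obtain ⟨Q, _, M, P, hP, hM⟩ := CounterMachine.exists_undecidable
  have := Fintype.ofFinite Q
  obtain ⟨K, hK⟩ : ∃ K, 2 < K ∧ (∀ q, M.test q < K) ∧ ∀ q, ∀ r ∈ M.add q, r < K := by
    have hle (q) : M.test q + (M.add q).getD 0 ≤ ∑ q, (M.test q + (M.add q).getD 0) :=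
      Finset.single_le_sum (f := fun q => M.test q + (M.add q).getD 0)
        (fun _ _ => Nat.zero_le _) (Finset.mem_univ q)
    refine ⟨3 + ∑ q, (M.test q + (M.add q).getD 0), by omega, fun q => ?_, fun q r hr => ?_⟩
    · have := hle q
      omega
    · have := hle q
      rw [Option.mem_def.1 hr, Option.getD_some] at this
      omega
  obtain ⟨hK, ht, ha⟩ := hK
  set M' := M.restrict K ht ha with hM'
  let c : ℕ → Fin K → ℕ := fun m i => Function.update (0 : ℕ → ℕ) 1 m i
  have hiter : ∀ m n, M'.step^[n] (some M'.start, c m) =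
      ((M.step^[n] (some M.start, Function.update 0 1 m)).1, fun i : Fin K =>
        (M.step^[n] (some M.start, Function.update 0 1 m)).2 i) := fun m n =>
    M.restrict_iterate K ht ha n (some M.start, Function.update 0 1 m)
  have hstable : ∀ m, P m ↔ M'.layout.net.Stable (M'.initial (c m)) := by
    refine fun m => ⟨fun h => ?_, fun h => ?_⟩
    · obtain ⟨n, c', hn⟩ := (hM m).1 h
      refine CounterMachine.stable_of_halts (n := n) (c' := fun i => c' i) ?_
      rw [hiter, hn]
    · by_contra hm
      refine CounterMachine.not_stable_of_unbounded ⟨2, hK⟩ (fun k => ?_) h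
      obtain ⟨n, hn⟩ := (hM m).2 hm k
      exact ⟨n, by rw [hiter]; exact hn⟩
  have hprim : ∀ i, Primrec fun m => M'.initial (c m) i := by
    intro i
    obtain ⟨i, rfl⟩ := M'.layout.cls.surjective i
    simp only [CounterMachine.initial, Equiv.symm_apply_apply, Function.update_apply]
    split_ifs
    · exact .const _
    rcases i with r | r | _ | _ | _ | _ | _ | _ | _ | _
    case token =>
      simp only [CounterMachine.tokens, c, Function.update_apply]
      split_ifs
      · exact .id
      · exact .const _
    all_goals exact .const _
  refine fun h => hP (ComputablePred.computable_of_manyOneReducible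
    ⟨fun m => M'.layout.net.code (M'.initial (c m)),
      (M'.layout.net.primrec_code hprim).to_comp, fun m => ?_⟩ h)
  rw [hstable]
  refine ⟨fun hs => ⟨_, _, rfl, M'.layout_good.wellFormed, hs⟩, ?_⟩
  rintro ⟨net, Q0, hc, -, hs⟩
  exact (MQNet.code_injective hc).1 hs
end
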